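/- arXiv:1812.08734 — 3 statements merged into one kernel-verified Lean document; each statement's English description precedes it below -/
import Mathlib

section
/- Let f : ℝⁿ → ℝ be a Schwartz function whose Fourier transform f̂ vanishes in a neighborhood of the origin, and let m : ℝⁿ \ {0} → ℂ be a Fourier multiplier which is smooth away from the origin and positively homogeneous of degree s. Suppose λ > 0 and one of the following holds: (1) supp f̂ ⊆ {|ξ| ≤ λ} and s > 0; (2) supp f̂ ⊆ {|ξ| ≥ λ} and s < 0; (3) supp f̂ ⊆ {λ/2 ≤ |ξ| ≤ 2λ} and s ∈ ℝ. Then ‖(m f̂)^∨‖_{C⁰} ≤ C λ^s ‖f‖_{C⁰}, where C depends only on n and m (not on f or λ). -/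
open Real MeasureTheory
open scoped FourierTransform

section FourierMultiplier

open FourierTransform SchwartzMap

/-- A smooth cutoff `χ` whose associated annular cutoff localizes `m` to a Schwartz function. -/
lemma exists_cutoff_schwartz {V : Type*} [NormedAddCommGroup V] [InnerProductSpace ℝ V]
    [FiniteDimensional ℝ V] (m : V → ℂ)
    (hm : ContDiffOn ℝ (⊤ : ℕ∞) m {(0 : V)}ᶜ) :
    ∃ (χ : V → ℝ) (g : 𝓢(V, ℂ)), (∀ ξ, ‖ξ‖ ≤ 1 → χ ξ = 1) ∧ (∀ ξ, 2 ≤ ‖ξ‖ → χ ξ = 0) ∧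
      (∀ ξ, |χ ξ| ≤ 1) ∧ ∀ ξ, g ξ = m ξ * ((χ ξ - χ ((2 : ℝ) • ξ) : ℝ) : ℂ) := by
  let χ : ContDiffBump (0 : V) := ⟨1, 2, one_pos, one_lt_two⟩
  have h1 : ∀ ξ, ‖ξ‖ ≤ 1 → χ ξ = 1 := fun ξ hξ ↦
    χ.one_of_mem_closedBall (by simpa [χ] using hξ)
  have h2 : ∀ ξ, 2 ≤ ‖ξ‖ → χ ξ = 0 := fun ξ hξ ↦
    χ.zero_of_le_dist (by simpa [χ] using hξ)
  have hsupp : HasCompactSupport fun ξ ↦ m ξ * ((χ ξ - χ ((2 : ℝ) • ξ) : ℝ) : ℂ) := by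
    refine HasCompactSupport.intro (isCompact_closedBall (0 : V) 2) fun ξ hξ ↦ ?_
    have hξ' : 2 < ‖ξ‖ := by simpa using hξ
    rw [h2 ξ hξ'.le, h2 _ (by rw [norm_smul]; norm_num; linarith)]
    simp
  have hsmooth : ContDiff ℝ (⊤ : ℕ∞) fun ξ ↦ m ξ * ((χ ξ - χ ((2 : ℝ) • ξ) : ℝ) : ℂ) := by
    rw [contDiff_iff_contDiffAt]
    intro ξ
    by_cases hξ : ξ = 0
    · refine (contDiffAt_const (c := (0 : ℂ))).congr_of_eventuallyEq ?_
      filter_upwards [Metric.ball_mem_nhds ξ (show (0 : ℝ) < 1 / 2 by norm_num)] with η hη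
      have hη' : ‖η‖ < 1 / 2 := by simpa [hξ] using hη
      rw [h1 η (by linarith), h1 _ (by rw [norm_smul]; norm_num; linarith)]
      simp
    · refine (hm.contDiffAt (isOpen_compl_singleton.mem_nhds hξ)).mul ?_
      refine Complex.ofRealCLM.contDiff.contDiffAt.comp ξ ?_
      exact (χ.contDiff.sub (χ.contDiff.comp (contDiff_const_smul _))).contDiffAt
  refine ⟨χ, hsupp.toSchwartzMap hsmooth, h1, h2, fun ξ ↦ ?_, fun ξ ↦ rfl⟩
  rw [abs_of_nonneg χ.nonneg]
  exact χ.le_one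

/-- Dyadic telescoping for a homogeneous symbol. -/
lemma homogeneous_mul_cutoff_eq_sum {V : Type*} [NormedAddCommGroup V] [NormedSpace ℝ V]
    {s : ℝ} {m : V → ℂ}
    (hm : ∀ t : ℝ, 0 < t → ∀ ξ : V, ξ ≠ 0 → m (t • ξ) = Complex.ofReal (t ^ s) * m ξ)
    {χ : V → ℝ} {g : V → ℂ} (hg : ∀ ξ, g ξ = m ξ * ((χ ξ - χ ((2 : ℝ) • ξ) : ℝ) : ℂ))
    {ρ : ℝ} (hρ : 0 < ρ) (N : ℕ) (ξ : V) :
    m ξ * ((χ ((2 ^ N * ρ)⁻¹ • ξ) - χ (ρ⁻¹ • ξ) : ℝ) : ℂ) =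
      ∑ k ∈ Finset.range N, (((2 ^ (k + 1) * ρ) ^ s : ℝ) : ℂ) * g ((2 ^ (k + 1) * ρ)⁻¹ • ξ) := by
  by_cases hξ : ξ = 0
  · simp [hξ, hg]
  have hterm : ∀ k : ℕ, (((2 ^ (k + 1) * ρ) ^ s : ℝ) : ℂ) * g ((2 ^ (k + 1) * ρ)⁻¹ • ξ) =
      m ξ * ((χ ((2 ^ (k + 1) * ρ)⁻¹ • ξ) - χ ((2 ^ k * ρ)⁻¹ • ξ) : ℝ) : ℂ) := fun k ↦ by
    have ht : (0 : ℝ) < 2 ^ (k + 1) * ρ := by positivity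
    have h := hm _ ht ((2 ^ (k + 1) * ρ)⁻¹ • ξ) (smul_ne_zero (inv_ne_zero ht.ne') hξ)
    rw [smul_inv_smul₀ ht.ne'] at h
    have h2 : (2 : ℝ) * (2 ^ (k + 1) * ρ)⁻¹ = (2 ^ k * ρ)⁻¹ := by
      field_simp
      ring
    rw [hg, smul_smul, h2, h, mul_assoc]
  simp_rw [hterm]
  rw [← Finset.mul_sum, ← Complex.ofReal_sum,
    Finset.sum_range_sub (fun k ↦ χ ((2 ^ k * ρ)⁻¹ • ξ))]
  simp

variable {V : Type*} [NormedAddCommGroup V] [InnerProductSpace ℝ V] [FiniteDimensional ℝ V]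
  [MeasurableSpace V] [BorelSpace V]

/-- The Fourier transform of a modulated dilate of `g`. -/
lemma fourier_modulated_dilate (g : V → ℂ) {r : ℝ} (hr : 0 < r) (x y : V) :
    𝓕 (fun ξ ↦ Real.fourierChar (inner ℝ ξ x) • g (r⁻¹ • ξ)) y =
      ((r ^ Module.finrank ℝ V : ℝ) : ℂ) * 𝓕 g (r • (y - x)) := by
  rw [Real.fourier_eq, Real.fourier_eq]
  have h := Measure.integral_comp_smul (μ := (volume : Measure V))
    (fun η ↦ Real.fourierChar (-inner ℝ η (r • (y - x))) • g η) r⁻¹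
  have hr' : |((r⁻¹) ^ Module.finrank ℝ V)⁻¹| = r ^ Module.finrank ℝ V := by
    rw [abs_of_pos (by positivity), inv_pow, inv_inv]
  rw [hr'] at h
  rw [← Complex.real_smul, ← h]
  congr 1
  ext ξ
  rw [smul_smul, ← AddChar.map_add_eq_mul]
  congr 2
  rw [real_inner_smul_left, real_inner_smul_right, inner_sub_right]
  field_simp
  ring

lemma integrable_dilate_mul_fourier (f g : 𝓢(V, ℂ)) (r : ℝ) :
    Integrable (fun ξ ↦ g (r • ξ) * 𝓕 (⇑f) ξ) := by
  have hf : Integrable (𝓕 (⇑f)) := by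
    simpa [fourier_coe] using (𝓕 f).integrable (μ := volume)
  exact hf.bdd_mul (by fun_prop) (Filter.Eventually.of_forall fun ξ ↦
    g.toBoundedContinuousFunction.norm_coe_le_norm (r • ξ))

lemma norm_fourierInv_dilate_mul_fourier_le (f g : 𝓢(V, ℂ)) {r : ℝ} (hr : 0 < r) (x : V) :
    ‖𝓕⁻ (fun ξ ↦ g (r⁻¹ • ξ) * 𝓕 (⇑f) ξ) x‖ ≤ (∫ ξ, ‖𝓕 (⇑g) ξ‖) * ⨆ y, ‖f y‖ := by
  set v : V → ℂ := fun ξ ↦ Real.fourierChar (inner ℝ ξ x) • g (r⁻¹ • ξ) with hv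
  have hgi : Integrable (fun ξ ↦ g (r⁻¹ • ξ)) :=
    g.integrable.comp_smul (inv_ne_zero hr.ne')
  have hvi : Integrable v := by
    have h := (Real.fourierIntegral_convergent_iff (μ := volume) (-x)).2 hgi
    simpa [hv] using h
  have hflip : ∫ ξ, 𝓕 (⇑f) ξ • v ξ = ∫ y, f y • 𝓕 v y := by
    simpa using! VectorFourier.integral_fourierIntegral_smul_eq_flip (L := innerₗ V)
      Real.continuous_fourierChar continuous_inner f.integrable hvi
  have hinv : 𝓕⁻ (fun ξ ↦ g (r⁻¹ • ξ) * 𝓕 (⇑f) ξ) x = ∫ y, f y • 𝓕 v y := by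
    rw [← hflip, Real.fourierInv_eq]
    congr 1
    ext ξ
    simp only [hv, Circle.smul_def, smul_eq_mul]
    ring
  have hF : Integrable (fun ξ ↦ ‖𝓕 (⇑g) ξ‖) := by
    simpa [fourier_coe] using ((𝓕 g).integrable (μ := volume)).norm
  have hbdd : BddAbove (Set.range fun y ↦ ‖f y‖) :=
    ⟨_, Set.forall_mem_range.2 f.toBoundedContinuousFunction.norm_coe_le_norm⟩
  have hFv : ∀ y, ‖𝓕 v y‖ = r ^ Module.finrank ℝ V * ‖𝓕 (⇑g) (r • (y - x))‖ := fun y ↦ by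
    rw [hv, fourier_modulated_dilate _ hr, norm_mul, Complex.norm_real,
      Real.norm_of_nonneg (by positivity)]
  have hFi : Integrable (fun y ↦ r ^ Module.finrank ℝ V * ‖𝓕 (⇑g) (r • (y - x))‖) :=
    ((hF.comp_smul hr.ne').comp_sub_right x).const_mul _
  have hint : ∫ y, r ^ Module.finrank ℝ V * ‖𝓕 (⇑g) (r • (y - x))‖ = ∫ ξ, ‖𝓕 (⇑g) ξ‖ := by
    rw [integral_const_mul, integral_sub_right_eq_self (fun y ↦ ‖𝓕 (⇑g) (r • y)‖) x,
      Measure.integral_comp_smul volume (fun y ↦ ‖𝓕 (⇑g) y‖), abs_of_pos (by positivity),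
      smul_eq_mul, mul_inv_cancel_left₀ (by positivity)]
  rw [hinv, ← hint, ← integral_mul_const]
  refine norm_integral_le_of_norm_le (hFi.mul_const _) (Filter.Eventually.of_forall fun y ↦ ?_)
  rw [norm_smul, hFv, mul_comm]
  gcongr
  exact le_ciSup hbdd y

lemma norm_fourierInv_sum_dilates_le (f g : 𝓢(V, ℂ)) (s : ℝ) {ρ : ℝ} (hρ : 0 < ρ) (N : ℕ)
    (x : V) :
    ‖𝓕⁻ (fun ξ ↦ (∑ k ∈ Finset.range N,
        (((2 ^ (k + 1) * ρ) ^ s : ℝ) : ℂ) * g ((2 ^ (k + 1) * ρ)⁻¹ • ξ)) * 𝓕 (⇑f) ξ) x‖ ≤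
      (∫ ξ, ‖𝓕 (⇑g) ξ‖) * (ρ ^ s * ∑ k ∈ Finset.range N, ((2 : ℝ) ^ s) ^ (k + 1)) *
        ⨆ y, ‖f y‖ := by
  have heq : 𝓕⁻ (fun ξ ↦ (∑ k ∈ Finset.range N,
        (((2 ^ (k + 1) * ρ) ^ s : ℝ) : ℂ) * g ((2 ^ (k + 1) * ρ)⁻¹ • ξ)) * 𝓕 (⇑f) ξ) x =
      ∑ k ∈ Finset.range N, (((2 ^ (k + 1) * ρ) ^ s : ℝ) : ℂ) *
        𝓕⁻ (fun ξ ↦ g ((2 ^ (k + 1) * ρ)⁻¹ • ξ) * 𝓕 (⇑f) ξ) x := by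
    simp_rw [Real.fourierInv_eq, ← integral_const_mul]
    rw [← integral_finsetSum]
    · congr 1
      ext ξ
      rw [Finset.sum_mul, Finset.smul_sum]
      refine Finset.sum_congr rfl fun k _ ↦ ?_
      simp only [Circle.smul_def, smul_eq_mul]
      ring
    · intro k _
      refine Integrable.const_mul ?_ _
      have h := (Real.fourierIntegral_convergent_iff (μ := volume) (-x)).2
        (integrable_dilate_mul_fourier f g (2 ^ (k + 1) * ρ)⁻¹)
      simpa using h
  rw [heq]
  refine (norm_sum_le _ _).trans ?_
  rw [Finset.mul_sum, Finset.mul_sum, Finset.sum_mul]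
  refine Finset.sum_le_sum fun k _ ↦ ?_
  have hpow : ((2 : ℝ) ^ (k + 1) * ρ) ^ s = ρ ^ s * ((2 : ℝ) ^ s) ^ (k + 1) := by
    rw [Real.mul_rpow (by positivity) hρ.le, ← Real.rpow_natCast, ← Real.rpow_mul zero_le_two,
      mul_comm _ s, Real.rpow_mul zero_le_two, Real.rpow_natCast, mul_comm]
  rw [norm_mul, Complex.norm_real, Real.norm_of_nonneg (by positivity), ← hpow]
  calc _ ≤ (2 ^ (k + 1) * ρ) ^ s * ((∫ ξ, ‖𝓕 (⇑g) ξ‖) * ⨆ y, ‖f y‖) := by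
        gcongr
        exact norm_fourierInv_dilate_mul_fourier_le f g (by positivity) x
    _ = _ := by ring

end FourierMultiplier

/-- **Bernstein-type inequality for homogeneous Fourier multipliers.**
If `m` is smooth away from the origin and positively homogeneous of degree `s`, then for
frequency-localized Schwartz functions `f` one has `‖(m f̂)^∨‖_{C⁰} ≤ C λ^s ‖f‖_{C⁰}`,
with `C` depending only on the dimension and on `m`. -/
theorem bernstein_inequality
    (n : ℕ) (s : ℝ) (m : EuclideanSpace ℝ (Fin n) → ℂ)
    (hm_smooth : ContDiffOn ℝ (⊤ : ℕ∞) m {(0 : EuclideanSpace ℝ (Fin n))}ᶜ)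
    (hm_hom : ∀ t : ℝ, 0 < t → ∀ ξ : EuclideanSpace ℝ (Fin n), ξ ≠ 0 →
      m (t • ξ) = Complex.ofReal (t ^ s) * m ξ) :
    ∃ C : ℝ, 0 < C ∧
      ∀ (f : SchwartzMap (EuclideanSpace ℝ (Fin n)) ℂ) (lam : ℝ), 0 < lam →
        -- f̂ vanishes in a neighborhood of the origin
        (∃ ε : ℝ, 0 < ε ∧ ∀ ξ : EuclideanSpace ℝ (Fin n), ‖ξ‖ < ε → 𝓕 (⇑f) ξ = 0) →
        -- one of the three frequency-support/homogeneity-sign conditions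
        ((Function.support (𝓕 (⇑f)) ⊆ {ξ | ‖ξ‖ ≤ lam} ∧ 0 < s) ∨
          (Function.support (𝓕 (⇑f)) ⊆ {ξ | lam ≤ ‖ξ‖} ∧ s < 0) ∨
          Function.support (𝓕 (⇑f)) ⊆ {ξ | lam / 2 ≤ ‖ξ‖ ∧ ‖ξ‖ ≤ 2 * lam}) →
        ∀ x, ‖𝓕⁻ (fun ξ => m ξ * 𝓕 (⇑f) ξ) x‖ ≤ C * lam ^ s * ⨆ y, ‖f y‖ := by
  obtain ⟨χ, g, hχ1, hχ0, hχb, hg⟩ := exists_cutoff_schwartz m hm_smooth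
  set c := ∫ ξ, ‖𝓕 (⇑g) ξ‖ with hc
  have hc0 : 0 ≤ c := integral_nonneg fun _ ↦ norm_nonneg _
  set Q : ℝ := 2 ^ s with hQ
  have hQ0 : 0 < Q := by positivity
  set A := Q * |Q - 1|⁻¹ + |1 - Q|⁻¹ + (Q⁻¹ + 1 + Q) with hA
  have hA0 : 0 ≤ A := by positivity
  have hA1 : Q * |Q - 1|⁻¹ ≤ A := by
    have : 0 ≤ |1 - Q|⁻¹ + (Q⁻¹ + 1 + Q) := by positivity
    linarith
  have hA2 : |1 - Q|⁻¹ ≤ A := by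
    have : 0 ≤ Q * |Q - 1|⁻¹ + (Q⁻¹ + 1 + Q) := by positivity
    linarith
  have hA3 : Q⁻¹ + 1 + Q ≤ A := by
    have : 0 ≤ Q * |Q - 1|⁻¹ + |1 - Q|⁻¹ := by positivity
    linarith
  refine ⟨c * A + 1, by positivity, fun f lam hlam ⟨ε, hε, hfε⟩ hcases x ↦ ?_⟩
  have hM : 0 ≤ ⨆ y, ‖f y‖ := Real.iSup_nonneg fun _ ↦ norm_nonneg _
  have hlams : 0 < lam ^ s := by positivity
  have hfinal : ∀ B : ℝ, B ≤ lam ^ s * A →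
      c * B * (⨆ y, ‖f y‖) ≤ (c * A + 1) * lam ^ s * ⨆ y, ‖f y‖ := fun B hB ↦ by
    refine mul_le_mul_of_nonneg_right ?_ hM
    nlinarith [mul_le_mul_of_nonneg_left hB hc0]
  have htrunc : ∀ (ρ : ℝ) (N : ℕ), 0 < ρ →
      ρ ^ s * ∑ k ∈ Finset.range N, Q ^ (k + 1) ≤ lam ^ s * A →
      ‖𝓕⁻ (fun ξ ↦ m ξ * ((χ ((2 ^ N * ρ)⁻¹ • ξ) - χ (ρ⁻¹ • ξ) : ℝ) : ℂ) * 𝓕 (⇑f) ξ) x‖ ≤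
        (c * A + 1) * lam ^ s * ⨆ y, ‖f y‖ := fun ρ N hρ hB ↦ by
    simp_rw [homogeneous_mul_cutoff_eq_sum hm_hom hg hρ]
    exact (norm_fourierInv_sum_dilates_le f g s hρ N x).trans (hfinal _ hB)
  have hnorm : ∀ r : ℝ, 0 < r → ∀ ξ : EuclideanSpace ℝ (Fin n), ‖r⁻¹ • ξ‖ = ‖ξ‖ / r :=
    fun r hr ξ ↦ by
      rw [norm_smul, norm_inv, Real.norm_of_nonneg hr.le, div_eq_inv_mul]
  have hlow : ∀ r : ℝ, 0 < r → ∀ ξ : EuclideanSpace ℝ (Fin n), ‖ξ‖ ≤ r → χ (r⁻¹ • ξ) = 1 :=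
    fun r hr ξ hξ ↦ hχ1 _ (by rw [hnorm r hr, div_le_one hr]; exact hξ)
  have hhigh : ∀ r : ℝ, 0 < r → ∀ ξ : EuclideanSpace ℝ (Fin n), 2 * r ≤ ‖ξ‖ →
      χ (r⁻¹ • ξ) = 0 :=
    fun r hr ξ hξ ↦ hχ0 _ (by rw [hnorm r hr, le_div_iff₀ hr]; exact hξ)
  have hexact : ∀ (ρ : ℝ) (N : ℕ), 0 < ρ →
      ρ ^ s * ∑ k ∈ Finset.range N, Q ^ (k + 1) ≤ lam ^ s * A →
      (∀ ξ, 𝓕 (⇑f) ξ ≠ 0 → 2 * ρ ≤ ‖ξ‖ ∧ ‖ξ‖ ≤ 2 ^ N * ρ) →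
      ‖𝓕⁻ (fun ξ ↦ m ξ * 𝓕 (⇑f) ξ) x‖ ≤ (c * A + 1) * lam ^ s * ⨆ y, ‖f y‖ :=
    fun ρ N hρ hB hsupp ↦ by
      convert htrunc ρ N hρ hB using 4 with ξ
      by_cases hξ : 𝓕 (⇑f) ξ = 0
      · simp [hξ]
      · rw [hlow _ (by positivity) ξ (hsupp ξ hξ).2, hhigh ρ hρ ξ (hsupp ξ hξ).1]
        simp
  rcases hcases with ⟨hsupp, hs⟩ | ⟨hsupp, hs⟩ | hsupp
  · have hQ1 : 1 < Q := Real.one_lt_rpow one_lt_two hs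
    obtain ⟨N, hN⟩ := pow_unbounded_of_one_lt (2 * lam / ε) (one_lt_two (α := ℝ))
    have h2N : (2 : ℝ) ^ N * (lam / 2 ^ N) = lam := by field_simp
    refine hexact (lam / 2 ^ N) N (by positivity) ?_ fun ξ hξ ↦ ⟨?_, ?_⟩
    · have hpow : (lam / 2 ^ N) ^ s = lam ^ s * (Q ^ N)⁻¹ := by
        rw [Real.div_rpow hlam.le (by positivity), ← Real.rpow_natCast,
          ← Real.rpow_mul zero_le_two, mul_comm _ s, Real.rpow_mul zero_le_two,
          Real.rpow_natCast, div_eq_mul_inv]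
      rw [hpow, mul_assoc]
      refine mul_le_mul_of_nonneg_left (le_trans ?_ hA1) hlams.le
      have hpos : 0 < Q - 1 := by linarith
      simp_rw [pow_succ]
      rw [← Finset.sum_mul, geom_sum_eq hQ1.ne', abs_of_pos hpos]
      have hQN : 0 < Q ^ N := by positivity
      calc (Q ^ N)⁻¹ * ((Q ^ N - 1) / (Q - 1) * Q)
          = (1 - (Q ^ N)⁻¹) * (Q * (Q - 1)⁻¹) := by field_simp
        _ ≤ 1 * (Q * (Q - 1)⁻¹) := by
            gcongr
            linarith [inv_pos.2 hQN]
        _ = _ := one_mul _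
    · have hξε : ε ≤ ‖ξ‖ := by
        by_contra! h
        exact hξ (hfε ξ h)
      refine le_trans ?_ hξε
      rw [div_lt_iff₀ hε] at hN
      rw [← mul_div_assoc, div_le_iff₀ (by positivity)]
      linarith
    · rw [h2N]
      exact hsupp hξ
  · have hQ1 : Q < 1 := Real.rpow_lt_one_of_one_lt_of_neg one_lt_two hs
    by_cases hint : Integrable (fun ξ ↦ m ξ * 𝓕 (⇑f) ξ)
    swap
    · have hzero : 𝓕⁻ (fun ξ ↦ m ξ * 𝓕 (⇑f) ξ) x = 0 := by
        rw [Real.fourierInv_eq]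
        refine integral_undef fun h ↦ hint ?_
        refine (Real.fourierIntegral_convergent_iff (μ := volume) (-x)).1 ?_
        simpa using h
      rw [hzero, norm_zero]
      positivity
    have hρ : 0 < lam / 2 := by positivity
    have hB : ∀ N : ℕ, (lam / 2) ^ s * ∑ k ∈ Finset.range N, Q ^ (k + 1) ≤ lam ^ s * A := by
      intro N
      rw [Real.div_rpow hlam.le zero_le_two, ← hQ, div_eq_mul_inv, mul_assoc]
      refine mul_le_mul_of_nonneg_left (le_trans ?_ hA2) hlams.le
      simp_rw [pow_succ]
      rw [← Finset.sum_mul, mul_comm, mul_assoc, mul_inv_cancel₀ hQ0.ne', mul_one,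
        abs_of_pos (by linarith), ← tsum_geometric_of_lt_one hQ0.le hQ1]
      exact (summable_geometric_of_lt_one hQ0.le hQ1).sum_le_tsum _ fun _ _ ↦ by positivity
    refine le_of_tendsto' (f := fun N : ℕ ↦ ‖𝓕⁻ (fun ξ ↦ m ξ *
      ((χ ((2 ^ N * (lam / 2))⁻¹ • ξ) - χ ((lam / 2)⁻¹ • ξ) : ℝ) : ℂ) * 𝓕 (⇑f) ξ) x‖)
      (x := Filter.atTop) ?_ fun N ↦ htrunc _ N hρ (hB N)
    refine Filter.Tendsto.norm ?_
    simp_rw [Real.fourierInv_eq]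
    refine tendsto_integral_of_dominated_convergence (fun ξ ↦ ‖m ξ * 𝓕 (⇑f) ξ‖) (fun N ↦ ?_)
      hint.norm (fun N ↦ ?_) ?_
    · simp_rw [homogeneous_mul_cutoff_eq_sum hm_hom hg hρ, Finset.sum_mul, mul_assoc]
      have hi : Integrable fun ξ ↦ ∑ k ∈ Finset.range N,
          (((2 ^ (k + 1) * (lam / 2)) ^ s : ℝ) : ℂ) *
            (g ((2 ^ (k + 1) * (lam / 2))⁻¹ • ξ) * 𝓕 (⇑f) ξ) :=
        integrable_finsetSum _ fun k _ ↦ (integrable_dilate_mul_fourier f g _).const_mul _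
      have h := (Real.fourierIntegral_convergent_iff (μ := volume) (-x)).2 hi
      simpa using h.aestronglyMeasurable
    · refine Filter.Eventually.of_forall fun ξ ↦ ?_
      rw [Circle.norm_smul]
      by_cases hξ : 𝓕 (⇑f) ξ = 0
      · simp [hξ]
      · have hl : lam ≤ ‖ξ‖ := hsupp hξ
        rw [hhigh _ hρ ξ (by linarith), sub_zero, mul_right_comm, norm_mul, Complex.norm_real]
        exact mul_le_of_le_one_right (norm_nonneg _) (hχb _)
    · refine Filter.Eventually.of_forall fun ξ ↦ tendsto_const_nhds.congr' ?_
      obtain ⟨N₀, hN₀⟩ := pow_unbounded_of_one_lt (‖ξ‖ / (lam / 2)) (one_lt_two (α := ℝ))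
      filter_upwards [Filter.eventually_ge_atTop N₀] with N hN
      by_cases hξ : 𝓕 (⇑f) ξ = 0
      · simp [hξ]
      · have hl : lam ≤ ‖ξ‖ := hsupp hξ
        have hle : ‖ξ‖ ≤ 2 ^ N * (lam / 2) := by
          rw [← div_le_iff₀ hρ]
          exact hN₀.le.trans (pow_le_pow_right₀ one_le_two hN)
        rw [hhigh _ hρ ξ (by linarith), hlow _ (by positivity) ξ hle]
        simp
  · refine hexact (lam / 4) 3 (by positivity) ?_ fun ξ hξ ↦ ?_
    · have h4 : (4 : ℝ) ^ s = Q ^ 2 := by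
        rw [show (4 : ℝ) = 2 * 2 by norm_num, Real.mul_rpow zero_le_two zero_le_two, sq]
      rw [Real.div_rpow hlam.le (by norm_num), h4, div_eq_mul_inv, mul_assoc]
      refine mul_le_mul_of_nonneg_left (le_trans (le_of_eq ?_) hA3) hlams.le
      simp only [Finset.sum_range_succ, Finset.sum_range_zero]
      field_simp
      ring
    · obtain ⟨h1, h2⟩ := hsupp hξ
      exact ⟨by linarith, by linarith⟩
end

section
/- Let f : 𝕋³ → ℝ be a smooth function such that f(·,·,z) has zero mean on 𝕋² for every z ∈ [0,2π], and suppose that every nonzero Fourier mode k = (k₁,k₂,k₃) ∈ ℤ³ of f satisfies |(k₁,k₂)| ≥ λ for some λ > 0. Then there exists a smooth 2×2 matrix field E : 𝕋³ → ℝ^{2×2} which is symmetric and traceless at every point, such that the horizontal divergence of E taken row by row equals the horizontal gradient of f (that is, Σ_{j=1,2} ∂_j E_{ij} = ∂_i f for i = 1,2), and which satisfies ‖E‖_{C⁰} ≤ C λ^{−1} ‖∇̄f‖_{C⁰}, with C a universal constant. -/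
open Real MeasureTheory

noncomputable section

/-- Partial derivative of a scalar function in the `i`-th coordinate direction. -/
def pd3 (i : Fin 3) (f : (Fin 3 → ℝ) → ℝ) (x : Fin 3 → ℝ) : ℝ :=
  fderiv ℝ f x (Pi.single i 1)

/-- The fundamental domain `[0,2π]³` of the torus `𝕋³ = (ℝ/2πℤ)³`. -/
def box3 : Set (Fin 3 → ℝ) := Set.Icc 0 (fun _ => 2 * Real.pi)

/-- The fundamental domain `[0,2π]²` of the torus `𝕋² = (ℝ/2πℤ)²`. -/
def box2 : Set (Fin 2 → ℝ) := Set.Icc 0 (fun _ => 2 * Real.pi)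

/-- `2π`-periodicity in each of the three spatial variables. -/
def Periodic3 {E : Type*} (f : (Fin 3 → ℝ) → E) : Prop :=
  ∀ (x : Fin 3 → ℝ) (i : Fin 3), f (x + Pi.single i (2 * Real.pi)) = f x

/-- The `ℤ³` Fourier coefficient of `F : 𝕋³ → ℂ` at frequency `k = (k̄, k₃) ∈ ℤ² × ℤ`. -/
def fc3 (F : (Fin 3 → ℝ) → ℂ) (k : (ℤ × ℤ) × ℤ) : ℂ :=
  ((2 * Real.pi) ^ 3 : ℝ)⁻¹ • ∫ x in box3,
    F x * Complex.exp (-(Complex.I) *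
      Complex.ofReal ((k.1.1 : ℝ) * x 0 + (k.1.2 : ℝ) * x 1 + (k.2 : ℝ) * x 2))

/-- The Euclidean length of a horizontal frequency `k̄ ∈ ℤ²`. -/
def knorm (k : ℤ × ℤ) : ℝ := Real.sqrt ((k.1 : ℝ) ^ 2 + (k.2 : ℝ) ^ 2)

/-! ### Plane waves and trigonometric series on `𝕋³` -/

/-- The linear phase `x ↦ k · x`. -/
def phase (k : (ℤ × ℤ) × ℤ) : (Fin 3 → ℝ) →L[ℝ] ℝ :=
  (k.1.1 : ℝ) • ContinuousLinearMap.proj 0 + (k.1.2 : ℝ) • ContinuousLinearMap.proj 1 +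
    (k.2 : ℝ) • ContinuousLinearMap.proj 2

lemma phase_apply (k : (ℤ × ℤ) × ℤ) (x : Fin 3 → ℝ) :
    phase k x = (k.1.1 : ℝ) * x 0 + (k.1.2 : ℝ) * x 1 + (k.2 : ℝ) * x 2 := by
  simp [phase]

/-- The `i`-th component of a frequency. -/
def freqComp (k : (ℤ × ℤ) × ℤ) : Fin 3 → ℤ := ![k.1.1, k.1.2, k.2]

lemma phase_single (k : (ℤ × ℤ) × ℤ) (i : Fin 3) (t : ℝ) :
    phase k (Pi.single i t) = freqComp k i * t := by
  fin_cases i <;> simp [phase_apply, freqComp]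

/-- The plane wave `x ↦ exp (i k · x)`. -/
def planeWave (k : (ℤ × ℤ) × ℤ) (x : Fin 3 → ℝ) : ℂ :=
  Complex.exp (Complex.I * (phase k x : ℝ))

lemma norm_planeWave (k : (ℤ × ℤ) × ℤ) (x : Fin 3 → ℝ) : ‖planeWave k x‖ = 1 := by
  rw [planeWave, mul_comm, Complex.norm_exp_ofReal_mul_I]

lemma planeWave_add (k : (ℤ × ℤ) × ℤ) (x y : Fin 3 → ℝ) :
    planeWave k (x + y) = planeWave k x * planeWave k y := by
  rw [planeWave, planeWave, planeWave, ← Complex.exp_add, map_add, Complex.ofReal_add, mul_add]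

lemma planeWave_periodic (k : (ℤ × ℤ) × ℤ) : Periodic3 (planeWave k) := by
  intro x i
  rw [planeWave_add]
  suffices planeWave k (Pi.single i (2 * Real.pi)) = 1 by rw [this, mul_one]
  rw [planeWave, phase_single, Complex.exp_eq_one_iff]
  exact ⟨freqComp k i, by push_cast; ring⟩

lemma contDiff_planeWave (k : (ℤ × ℤ) × ℤ) {n : WithTop ℕ∞} : ContDiff ℝ n (planeWave k) := by
  unfold planeWave
  exact (contDiff_const.mul (Complex.ofRealCLM.contDiff.comp (phase k).contDiff)).cexp

lemma hasFDerivAt_planeWave (k : (ℤ × ℤ) × ℤ) (x : Fin 3 → ℝ) :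
    HasFDerivAt (planeWave k)
      ((Complex.I * planeWave k x) • (Complex.ofRealCLM.comp (phase k))) x := by
  have h := ((Complex.ofRealCLM.comp (phase k)).hasFDerivAt (x := x)).const_mul Complex.I
  refine h.cexp.congr_fderiv ?_
  ext v
  simp [planeWave]
  ring

/-- The weight `∏ᵢ (1 + kᵢ²)` measuring decay of Fourier coefficients. -/
def freqWeight (k : (ℤ × ℤ) × ℤ) : ℝ := ∏ i, (1 + (freqComp k i : ℝ) ^ 2)

lemma one_le_freqWeight (k : (ℤ × ℤ) × ℤ) : 1 ≤ freqWeight k :=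
  Finset.one_le_prod fun _ _ => le_add_of_nonneg_right (sq_nonneg _)

lemma freqWeight_pos (k : (ℤ × ℤ) × ℤ) : 0 < freqWeight k :=
  zero_lt_one.trans_le (one_le_freqWeight k)

lemma abs_freqComp_le (k : (ℤ × ℤ) × ℤ) (i : Fin 3) : |(freqComp k i : ℝ)| ≤ freqWeight k := by
  have h : 1 + (freqComp k i : ℝ) ^ 2 ≤ freqWeight k := by
    rw [freqWeight, ← Finset.mul_prod_erase _ _ (Finset.mem_univ i)]
    exact le_mul_of_one_le_right (by positivity)
      (Finset.one_le_prod fun _ _ => le_add_of_nonneg_right (sq_nonneg _))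
  refine le_trans ?_ h
  rw [← sq_abs]
  nlinarith [sq_nonneg (|(freqComp k i : ℝ)| - 1), abs_nonneg (freqComp k i : ℝ)]

lemma norm_phase_le (k : (ℤ × ℤ) × ℤ) : ‖phase k‖ ≤ 3 * freqWeight k := by
  refine ContinuousLinearMap.opNorm_le_bound _ (by linarith [freqWeight_pos k]) fun x => ?_
  have h : phase k x = ∑ i, (freqComp k i : ℝ) * x i := by
    simp [phase_apply, freqComp, Fin.sum_univ_three]
  rw [h]
  calc ‖∑ i, (freqComp k i : ℝ) * x i‖ ≤ ∑ _i : Fin 3, freqWeight k * ‖x‖ := by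
        refine norm_sum_le_of_le _ fun i _ => ?_
        rw [norm_mul]
        exact mul_le_mul (abs_freqComp_le k i) (norm_le_pi_norm x i) (norm_nonneg _)
          (freqWeight_pos k).le
    _ = 3 * freqWeight k * ‖x‖ := by simp; ring

lemma summable_inv_freqWeight : Summable fun k => (freqWeight k)⁻¹ := by
  have h : Summable fun n : ℤ => (1 + (n : ℝ) ^ 2)⁻¹ := by
    refine Summable.of_norm_bounded_eventually
      (Real.summable_one_div_int_pow.mpr one_lt_two) ?_
    filter_upwards [(Set.finite_singleton (0 : ℤ)).compl_mem_cofinite] with n hn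
    have hn : (0 : ℝ) < (n : ℝ) ^ 2 := by
      have : (n : ℝ) ≠ 0 := by simpa using hn
      positivity
    rw [Real.norm_of_nonneg (by positivity), one_div]
    exact inv_anti₀ hn (by linarith)
  have h0 : ∀ n : ℤ, 0 ≤ (1 + (n : ℝ) ^ 2)⁻¹ := fun n => by positivity
  refine ((h.mul_of_nonneg h h0 h0).mul_of_nonneg h
    (fun p => mul_nonneg (h0 _) (h0 _)) h0).congr fun k => ?_
  simp [freqWeight, freqComp, Fin.prod_univ_three, mul_comm]

/-- Decay of a coefficient family faster than any power of the frequency. -/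
def RapidDecay (a : (ℤ × ℤ) × ℤ → ℂ) : Prop :=
  ∀ M : ℕ, ∃ B : ℝ, ∀ k, freqWeight k ^ M * ‖a k‖ ≤ B

lemma RapidDecay.mul {a m : (ℤ × ℤ) × ℤ → ℂ} (ha : RapidDecay a)
    (hm : ∀ k, ‖m k‖ ≤ freqWeight k) : RapidDecay fun k => m k * a k := by
  intro M
  obtain ⟨B, hB⟩ := ha (M + 1)
  refine ⟨B, fun k => le_trans ?_ (hB k)⟩
  rw [norm_mul, pow_succ, mul_assoc]
  have := freqWeight_pos k
  gcongr
  exact hm k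

lemma RapidDecay.summable_pow_mul {a : (ℤ × ℤ) × ℤ → ℂ} (ha : RapidDecay a) (j : ℕ) :
    Summable fun k => freqWeight k ^ j * ‖a k‖ := by
  obtain ⟨B, hB⟩ := ha (j + 1)
  refine Summable.of_nonneg_of_le (fun k => ?_) (fun k => ?_) (summable_inv_freqWeight.mul_left B)
  · have := freqWeight_pos k
    positivity
  · rw [← div_eq_mul_inv, le_div_iff₀ (freqWeight_pos k)]
    calc _ = freqWeight k ^ (j + 1) * ‖a k‖ := by ring
      _ ≤ B := hB k

lemma RapidDecay.summable_norm {a : (ℤ × ℤ) × ℤ → ℂ} (ha : RapidDecay a) :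
    Summable fun k => ‖a k‖ := by
  simpa using ha.summable_pow_mul 0

/-- The trigonometric series with coefficients `a`. -/
def trigSeries (a : (ℤ × ℤ) × ℤ → ℂ) (x : Fin 3 → ℝ) : ℂ := ∑' k, a k * planeWave k x

lemma RapidDecay.summable {a : (ℤ × ℤ) × ℤ → ℂ} (ha : RapidDecay a) (x : Fin 3 → ℝ) :
    Summable fun k => a k * planeWave k x :=
  .of_norm (by simpa [norm_planeWave] using ha.summable_norm)

lemma trigSeries_periodic (a : (ℤ × ℤ) × ℤ → ℂ) : Periodic3 (trigSeries a) := fun x i => by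
  simp only [trigSeries, planeWave_periodic _ x i]

lemma iteratedDeriv_exp_I_mul_ofReal (j : ℕ) :
    iteratedDeriv j (fun t : ℝ => Complex.exp (Complex.I * t)) =
      fun t : ℝ => Complex.I ^ j * Complex.exp (Complex.I * t) := by
  induction j with
  | zero => simp
  | succ j ih =>
    rw [iteratedDeriv_succ, ih]
    ext t
    have h := (((hasDerivAt_id' t).ofReal_comp.const_mul Complex.I).cexp).const_mul (Complex.I ^ j)
    rw [HasDerivAt.deriv h]
    rw [Complex.ofReal_one]
    ring

lemma norm_iteratedFDeriv_planeWave_le (k : (ℤ × ℤ) × ℤ) (j : ℕ) (x : Fin 3 → ℝ) :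
    ‖iteratedFDeriv ℝ j (planeWave k) x‖ ≤ (3 * freqWeight k) ^ j := by
  have hcd : ContDiff ℝ j fun t : ℝ => Complex.exp (Complex.I * t) :=
    (contDiff_const.mul Complex.ofRealCLM.contDiff).cexp
  have hcomp : planeWave k = (fun t : ℝ => Complex.exp (Complex.I * t)) ∘ phase k := rfl
  rw [hcomp, (phase k).iteratedFDeriv_comp_right hcd x le_rfl]
  refine (ContinuousMultilinearMap.norm_compContinuousLinearMap_le _ _).trans ?_
  rw [norm_iteratedFDeriv_eq_norm_iteratedDeriv, iteratedDeriv_exp_I_mul_ofReal, norm_mul,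
    mul_comm Complex.I, Complex.norm_exp_ofReal_mul_I]
  simpa using pow_le_pow_left₀ (norm_nonneg _) (norm_phase_le k) j

lemma RapidDecay.contDiff {a : (ℤ × ℤ) × ℤ → ℂ} (ha : RapidDecay a) :
    ContDiff ℝ (⊤ : ℕ∞) (trigSeries a) := by
  refine contDiff_tsum (v := fun j k => 3 ^ j * (freqWeight k ^ j * ‖a k‖))
    (fun k => contDiff_const.mul (contDiff_planeWave k))
    (fun j _ => (ha.summable_pow_mul j).mul_left _) fun j k x _ => ?_
  have h : (fun x => a k * planeWave k x) = a k • planeWave k := rfl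
  rw [h, iteratedFDeriv_const_smul_apply (contDiff_planeWave k).contDiffAt, norm_smul]
  calc ‖a k‖ * ‖iteratedFDeriv ℝ j (planeWave k) x‖ ≤ ‖a k‖ * (3 * freqWeight k) ^ j := by
        gcongr
        exact norm_iteratedFDeriv_planeWave_le k j x
    _ = 3 ^ j * (freqWeight k ^ j * ‖a k‖) := by rw [mul_pow]; ring

/-- Multiplication of a coefficient family by the symbol of `∂ᵢ`. -/
def coeffDeriv (i : Fin 3) (a : (ℤ × ℤ) × ℤ → ℂ) (k : (ℤ × ℤ) × ℤ) : ℂ :=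
  (Complex.I * freqComp k i) * a k

lemma RapidDecay.deriv {a : (ℤ × ℤ) × ℤ → ℂ} (ha : RapidDecay a) (i : Fin 3) :
    RapidDecay (coeffDeriv i a) :=
  ha.mul fun k => by simpa using abs_freqComp_le k i

lemma RapidDecay.fderiv_trigSeries_single {a : (ℤ × ℤ) × ℤ → ℂ} (ha : RapidDecay a) (i : Fin 3)
    (x : Fin 3 → ℝ) :
    fderiv ℝ (trigSeries a) x (Pi.single i 1) = trigSeries (coeffDeriv i a) x := by
  have hle : ∀ k x, ‖a k • ((Complex.I * planeWave k x) • (Complex.ofRealCLM.comp (phase k)))‖ ≤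
      3 * (freqWeight k ^ 1 * ‖a k‖) := fun k x => by
    have h1 : ‖Complex.ofRealCLM.comp (phase k)‖ ≤ 3 * freqWeight k := by
      refine (ContinuousLinearMap.opNorm_comp_le _ _).trans ?_
      rw [Complex.ofRealCLM_norm, one_mul]
      exact norm_phase_le k
    rw [norm_smul, norm_smul, norm_mul, norm_planeWave, Complex.norm_I, one_mul, one_mul, pow_one]
    calc _ ≤ ‖a k‖ * (3 * freqWeight k) := by gcongr
      _ = _ := by ring
  have hs := (ha.summable_pow_mul 1).mul_left 3
  have hd := hasFDerivAt_tsum hs (fun k x => (hasFDerivAt_planeWave k x).const_smul (a k)) hle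
    (ha.summable 0) x
  have hd' : HasFDerivAt (trigSeries a) _ x := hd
  rw [hd'.fderiv]
  have hs' := Summable.of_norm_bounded hs fun k => hle k x
  refine ((ContinuousLinearMap.apply ℝ ℂ (Pi.single i (1 : ℝ))).map_tsum hs').trans
    (tsum_congr fun k => ?_)
  simp [phase_single, coeffDeriv]
  ring

/-! ### Fourier expansion of smooth periodic functions -/

lemma integral_box3_fderiv_single_eq_zero {G : (Fin 3 → ℝ) → ℂ} (hG : ContDiff ℝ 1 G)
    (hp : Periodic3 G) (i : Fin 3) : ∫ x in box3, fderiv ℝ G x (Pi.single i 1) = 0 := by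
  have hc : Continuous fun x => fderiv ℝ G x (Pi.single i 1) :=
    (hG.continuous_fderiv one_ne_zero).clm_apply continuous_const
  have h0 : (0 : Fin 3 → ℝ) ≤ fun _ => 2 * Real.pi := fun _ => Real.two_pi_pos.le
  have hsum : ∀ x, ∑ j, ((if j = i then fderiv ℝ G x else 0 : (Fin 3 → ℝ) →L[ℝ] ℂ))
      (Pi.single j 1) = fderiv ℝ G x (Pi.single i 1) := fun x => by
    rw [Finset.sum_eq_single i (fun j _ hj => by simp [hj]) (by simp)]
    simp
  have h := integral_divergence_of_hasFDerivAt_off_countable' (0 : Fin 3 → ℝ)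
    (fun _ => 2 * Real.pi) h0 (fun j => if j = i then G else 0)
    (fun j x => if j = i then fderiv ℝ G x else 0) ∅ Set.countable_empty
    (fun j => by split_ifs; exacts [hG.continuous.continuousOn, continuousOn_const])
    (fun x _ j => by
      split_ifs
      exacts [(hG.differentiable one_ne_zero x).hasFDerivAt, hasFDerivAt_const 0 x])
    (by simpa only [hsum] using hc.integrableOn_Icc)
  simp only [hsum] at h
  rw [box3, h]
  refine Finset.sum_eq_zero fun j _ => sub_eq_zero.mpr ?_
  congr 1
  ext x
  split_ifs
  · refine Eq.trans (congrArg G ?_) (hp (j.insertNth 0 x) j)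
    ext l
    refine Fin.succAboveCases j ?_ (fun l => ?_) l
    · simp
    · simp
  · rfl

lemma Periodic3.fderiv {E : Type*} [NormedAddCommGroup E] [NormedSpace ℝ E]
    {G : (Fin 3 → ℝ) → E} (hp : Periodic3 G) : Periodic3 (fderiv ℝ G) := fun x i => by
  rw [← fderiv_comp_add_right]
  simp only [hp _ i]

lemma Periodic3.fderiv_single {G : (Fin 3 → ℝ) → ℂ} (hp : Periodic3 G) (v : Fin 3 → ℝ) :
    Periodic3 fun x => _root_.fderiv ℝ G x v := fun x i => by
  simp only [hp.fderiv x i]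

lemma contDiff_fderiv_apply {G : (Fin 3 → ℝ) → ℂ} (hG : ContDiff ℝ (⊤ : ℕ∞) G)
    (v : Fin 3 → ℝ) : ContDiff ℝ (⊤ : ℕ∞) fun x => fderiv ℝ G x v :=
  (hG.fderiv_right (m := (⊤ : ℕ∞)) (by simp)).clm_apply contDiff_const

lemma freqComp_neg (k : (ℤ × ℤ) × ℤ) (i : Fin 3) : freqComp (-k) i = -freqComp k i := by
  fin_cases i <;> simp [freqComp]

lemma fc3_eq (F : (Fin 3 → ℝ) → ℂ) (k : (ℤ × ℤ) × ℤ) :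
    fc3 F k = ((2 * Real.pi) ^ 3 : ℝ)⁻¹ • ∫ x in box3, F x * planeWave (-k) x := by
  have h : ∀ x, planeWave (-k) x = Complex.exp (-(Complex.I) *
      Complex.ofReal ((k.1.1 : ℝ) * x 0 + (k.1.2 : ℝ) * x 1 + (k.2 : ℝ) * x 2)) := fun x => by
    rw [planeWave, phase_apply]
    congr 1
    push_cast [Prod.fst_neg, Prod.snd_neg]
    ring
  simp only [h, fc3]

lemma integrableOn_box3_mul_planeWave {F : (Fin 3 → ℝ) → ℂ} (hF : Continuous F)
    (k : (ℤ × ℤ) × ℤ) : IntegrableOn (fun x => F x * planeWave k x) box3 :=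
  (hF.mul (contDiff_planeWave k (n := 0)).continuous).integrableOn_Icc

lemma fc3_fderiv_single {F : (Fin 3 → ℝ) → ℂ} (hF : ContDiff ℝ 1 F) (hp : Periodic3 F)
    (i : Fin 3) (k : (ℤ × ℤ) × ℤ) :
    fc3 (fun x => fderiv ℝ F x (Pi.single i 1)) k = coeffDeriv i (fc3 F) k := by
  have hz := integral_box3_fderiv_single_eq_zero (G := fun x => F x * planeWave (-k) x)
    (hF.mul (contDiff_planeWave _))
    (fun x j => by simp only [hp x j, planeWave_periodic (-k) x j]) i
  have hd : ∀ x, fderiv ℝ (fun x => F x * planeWave (-k) x) x (Pi.single i 1) =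
      fderiv ℝ F x (Pi.single i 1) * planeWave (-k) x -
        (Complex.I * freqComp k i) * (F x * planeWave (-k) x) := fun x => by
    have h := ((hF.differentiable one_ne_zero x).hasFDerivAt).mul (hasFDerivAt_planeWave (-k) x)
    have h' : HasFDerivAt (fun x => F x * planeWave (-k) x) _ x := h
    rw [h'.fderiv]
    simp [phase_single, freqComp_neg]
    ring
  simp only [hd] at hz
  have hc : Continuous fun x => fderiv ℝ F x (Pi.single i 1) :=
    (hF.continuous_fderiv one_ne_zero).clm_apply continuous_const
  rw [integral_sub (integrableOn_box3_mul_planeWave hc _)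
    ((integrableOn_box3_mul_planeWave hF.continuous _).const_mul _), sub_eq_zero,
    integral_const_mul] at hz
  rw [coeffDeriv, fc3_eq, fc3_eq, hz, mul_smul_comm]

lemma exists_norm_fc3_le {F : (Fin 3 → ℝ) → ℂ} :
    ∃ B : ℝ, ∀ k, ‖fc3 F k‖ ≤ B := by
  refine ⟨((2 * Real.pi) ^ 3 : ℝ)⁻¹ * ∫ x in box3, ‖F x‖, fun k => ?_⟩
  rw [fc3_eq, norm_smul, norm_inv, Real.norm_of_nonneg (by positivity)]
  gcongr
  refine (norm_integral_le_integral_norm _).trans_eq ?_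
  simp [norm_planeWave]

lemma fc3_sub {F G : (Fin 3 → ℝ) → ℂ} (hF : Continuous F) (hG : Continuous G)
    (k : (ℤ × ℤ) × ℤ) : fc3 (fun x => F x - G x) k = fc3 F k - fc3 G k := by
  simp only [fc3_eq, sub_mul]
  rw [integral_sub (integrableOn_box3_mul_planeWave hF _) (integrableOn_box3_mul_planeWave hG _),
    smul_sub]

/-- For every direction `i`, multiplication by `1 + kᵢ²` is realised by `1 - ∂ᵢ²`. -/
lemma exists_fc3_eq_one_add_sq_mul {F : (Fin 3 → ℝ) → ℂ} (hF : ContDiff ℝ (⊤ : ℕ∞) F)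
    (hp : Periodic3 F) (i : Fin 3) :
    ∃ G : (Fin 3 → ℝ) → ℂ, ContDiff ℝ (⊤ : ℕ∞) G ∧ Periodic3 G ∧
      ∀ k, fc3 G k = (1 + (freqComp k i : ℂ) ^ 2) * fc3 F k := by
  have hF1 := contDiff_fderiv_apply hF (Pi.single i 1)
  have hp1 := hp.fderiv_single (Pi.single i 1)
  have hF2 := contDiff_fderiv_apply hF1 (Pi.single i 1)
  have hp2 := hp1.fderiv_single (Pi.single i 1)
  refine ⟨_, hF.sub hF2, fun x j => by simp only [hp x j, hp2 x j], fun k => ?_⟩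
  rw [fc3_sub hF.continuous hF2.continuous, fc3_fderiv_single (hF1.of_le (by simp)) hp1,
    coeffDeriv, fc3_fderiv_single (hF.of_le (by simp)) hp, coeffDeriv]
  linear_combination (-(freqComp k i : ℂ) ^ 2 * fc3 F k) * Complex.I_sq

lemma rapidDecay_fc3 {F : (Fin 3 → ℝ) → ℂ} (hF : ContDiff ℝ (⊤ : ℕ∞) F) (hp : Periodic3 F) :
    RapidDecay (fc3 F) := by
  intro M
  induction M generalizing F with
  | zero => simpa using exists_norm_fc3_le
  | succ M ih =>
    obtain ⟨G₀, hG₀, hp₀, h₀⟩ := exists_fc3_eq_one_add_sq_mul hF hp 0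
    obtain ⟨G₁, hG₁, hp₁, h₁⟩ := exists_fc3_eq_one_add_sq_mul hG₀ hp₀ 1
    obtain ⟨G₂, hG₂, hp₂, h₂⟩ := exists_fc3_eq_one_add_sq_mul hG₁ hp₁ 2
    obtain ⟨B, hB⟩ := ih hG₂ hp₂
    refine ⟨B, fun k => (hB k).trans_eq' ?_⟩
    have h : fc3 G₂ k = (freqWeight k : ℂ) * fc3 F k := by
      rw [h₂, h₁, h₀, freqWeight, Fin.prod_univ_three]
      push_cast
      ring
    rw [h, norm_mul, Complex.norm_real, Real.norm_of_nonneg (freqWeight_pos k).le]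
    ring

/-- The frequencies of `fc3` as integer vectors. -/
def freqEquiv : (ℤ × ℤ) × ℤ ≃ (Fin 3 → ℤ) where
  toFun := freqComp
  invFun n := ((n 0, n 1), n 2)
  left_inv _ := rfl
  right_inv n := by
    ext i
    fin_cases i <;> rfl

lemma mFourier_freqComp (k : (ℤ × ℤ) × ℤ) (x : Fin 3 → ℝ) :
    UnitAddTorus.mFourier (freqComp k) (fun i => (x i : UnitAddCircle)) =
      planeWave k ((2 * Real.pi) • x) := by
  simp only [UnitAddTorus.mFourier, ContinuousMap.coe_mk, fourier_coe_apply, planeWave,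
    ← Complex.exp_sum, Fin.sum_univ_three, phase_apply]
  congr 1
  simp [freqComp]
  ring

lemma Periodic3.add_int_smul {E : Type*} {F : (Fin 3 → ℝ) → E} (hp : Periodic3 F)
    (x : Fin 3 → ℝ) (i : Fin 3) (n : ℤ) : F (x + Pi.single i (n * (2 * Real.pi))) = F x := by
  have h : Function.Periodic (fun t : ℝ => F (x + Pi.single i t)) (2 * Real.pi) := fun t => by
    simp only [Pi.single_add, ← add_assoc, hp _ i]
  simpa using h.int_mul n 0

lemma Periodic3.add_int {E : Type*} {F : (Fin 3 → ℝ) → E} (hp : Periodic3 F)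
    (x : Fin 3 → ℝ) (n : Fin 3 → ℤ) : F (x + fun i => n i * (2 * Real.pi)) = F x := by
  have h : (fun i => n i * (2 * Real.pi)) = Pi.single 0 (n 0 * (2 * Real.pi)) +
      Pi.single 1 (n 1 * (2 * Real.pi)) + Pi.single 2 (n 2 * (2 * Real.pi)) := by
    ext i
    fin_cases i <;> simp
  rw [h, ← add_assoc, ← add_assoc, hp.add_int_smul, hp.add_int_smul, hp.add_int_smul]

/-- A continuous `2π`-periodic function factors through the unit torus. -/
lemma Periodic3.exists_lift {F : (Fin 3 → ℝ) → ℂ} (hF : Continuous F) (hp : Periodic3 F) :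
    ∃ T : C(UnitAddTorus (Fin 3), ℂ),
      ∀ x : Fin 3 → ℝ, T (fun i => (x i : UnitAddCircle)) = F ((2 * Real.pi) • x) := by
  have hq : IsOpenQuotientMap
      (Pi.map fun (_ : Fin 3) (t : ℝ) => (t : UnitAddCircle)) :=
    .piMap fun _ => QuotientAddGroup.isOpenQuotientMap_mk
  let q : C(Fin 3 → ℝ, UnitAddTorus (Fin 3)) := ⟨_, hq.continuous⟩
  have hq' : Topology.IsQuotientMap q := hq.isQuotientMap
  let G : C(Fin 3 → ℝ, ℂ) := ⟨fun x => F ((2 * Real.pi) • x), by fun_prop⟩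
  have hfac : Function.FactorsThrough G q := by
    intro x y hxy
    have h : ∀ i, ∃ n : ℤ, x i = y i + n := fun i => by
      have hi : ((x i : ℝ) : UnitAddCircle) = (y i : ℝ) := congrFun hxy i
      rw [← sub_eq_zero, ← AddCircle.coe_sub, AddCircle.coe_eq_zero_iff] at hi
      obtain ⟨n, hn⟩ := hi
      exact ⟨n, by rw [zsmul_one] at hn; linarith⟩
    choose n hn using h
    have hx : (2 * Real.pi) • x = (2 * Real.pi) • y + fun i => n i * (2 * Real.pi) := by
      ext i
      simp [hn i]
      ring
    change F _ = F _
    rw [hx, hp.add_int]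
  exact ⟨hq'.lift G hfac, fun x => DFunLike.congr_fun (hq'.lift_comp G hfac) x⟩

open scoped Pointwise in
lemma mFourierCoeff_freqComp {F : (Fin 3 → ℝ) → ℂ} {T : UnitAddTorus (Fin 3) → ℂ}
    (hT : ∀ x : Fin 3 → ℝ, T (fun i => (x i : UnitAddCircle)) = F ((2 * Real.pi) • x))
    (k : (ℤ × ℤ) × ℤ) : UnitAddTorus.mFourierCoeff T (freqComp k) = fc3 F k := by
  have hneg : -freqComp k = freqComp (-k) := funext fun i => (freqComp_neg k i).symm
  rw [UnitAddTorus.mFourierCoeff_eq_integral T _ 0, hneg]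
  simp only [mFourier_freqComp, hT]
  rw [Measure.setIntegral_comp_smul_of_pos volume
    (fun y => planeWave (-k) y • F y) _ Real.two_pi_pos, fc3_eq]
  have hset : (2 * Real.pi) • {x : Fin 3 → ℝ | ∀ i, x i ∈ Set.Ioc ((0 : Fin 3 → ℝ) i)
      ((0 : Fin 3 → ℝ) i + 1)} = Set.univ.pi fun _ => Set.Ioc 0 (2 * Real.pi) := by
    ext y
    rw [Set.mem_smul_set_iff_inv_smul_mem₀ Real.two_pi_pos.ne']
    simp only [Set.mem_ofPred_eq, Set.mem_univ_pi]
    refine forall_congr' fun i => ?_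
    simp only [Set.mem_Ioc, Pi.smul_apply, smul_eq_mul, Pi.zero_apply, zero_add]
    rw [inv_mul_le_iff₀ Real.two_pi_pos, mul_one, mul_pos_iff_of_pos_left (by positivity)]
  have hae : (Set.univ.pi fun _ : Fin 3 => Set.Ioc 0 (2 * Real.pi)) =ᵐ[volume] box3 :=
    Measure.univ_pi_Ioc_ae_eq_Icc
  rw [hset, setIntegral_congr_set hae]
  simp [mul_comm]

/-- Smooth periodic functions are the sum of their Fourier series. -/
lemma eq_trigSeries_fc3 {F : (Fin 3 → ℝ) → ℂ} (hF : ContDiff ℝ (⊤ : ℕ∞) F)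
    (hp : Periodic3 F) : F = trigSeries (fc3 F) := by
  ext x
  obtain ⟨T, hT⟩ := hp.exists_lift hF.continuous
  have hs : Summable (UnitAddTorus.mFourierCoeff T) := by
    rw [← freqEquiv.summable_iff]
    exact (rapidDecay_fc3 hF hp).summable_norm.of_norm.congr fun k =>
      (mFourierCoeff_freqComp hT k).symm
  have h := (UnitAddTorus.hasSum_mFourier_series_apply_of_summable hs
    (fun i => (((2 * Real.pi)⁻¹ • x) i : UnitAddCircle))).tsum_eq
  rw [hT, smul_inv_smul₀ Real.two_pi_pos.ne', ← freqEquiv.tsum_eq] at h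
  rw [← h, trigSeries]
  refine tsum_congr fun k => ?_
  change UnitAddTorus.mFourierCoeff T (freqComp k) •
    UnitAddTorus.mFourier (freqComp k) (fun i => (((2 * Real.pi)⁻¹ • x) i : UnitAddCircle)) = _
  rw [mFourierCoeff_freqComp hT, mFourier_freqComp, smul_inv_smul₀ Real.two_pi_pos.ne',
    smul_eq_mul]

/-! ### The sup-norm estimate for high-frequency series -/

open scoped FourierTransform in
/-- There is an integrable kernel of unit mass with finite first moment whose Fourier transform
vanishes outside the unit ball. -/
lemma exists_bandlimited_kernel :
    ∃ ψ : ℂ → ℂ, Integrable ψ ∧ Integrable (fun w => ‖w‖ * ‖ψ w‖) ∧ ∫ w, ψ w = 1 ∧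
      ∀ ξ : ℂ, 1 ≤ ‖ξ‖ → ∫ w, Complex.exp (Complex.I * (inner ℝ ξ w : ℝ)) * ψ w = 0 := by
  have hr : 0 < (4 * Real.pi)⁻¹ := by positivity
  let χ : ContDiffBump (0 : ℂ) := ⟨(4 * Real.pi)⁻¹, (2 * Real.pi)⁻¹, hr, by
    gcongr; norm_num⟩
  have hsm : ContDiff ℝ (⊤ : ℕ∞) fun z => (χ z : ℂ) := Complex.ofRealCLM.contDiff.comp χ.contDiff
  have hsupp : HasCompactSupport fun z => (χ z : ℂ) :=
    χ.hasCompactSupport.comp_left (g := Complex.ofReal) Complex.ofReal_zero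
  let bumpS : SchwartzMap ℂ ℂ := hsupp.toSchwartzMap hsm
  let ψ : SchwartzMap ℂ ℂ := 𝓕⁻ bumpS
  have hψ : ∀ η, ∫ w, Complex.exp (↑(-2 * Real.pi * inner ℝ w η) * Complex.I) • ψ w =
      (χ η : ℂ) := fun η => by
    rw [← Real.fourier_eq', ← SchwartzMap.fourier_coe]
    simp only [ψ, FourierTransform.fourier_fourierInv_eq]
    rfl
  refine ⟨ψ, ψ.integrable, by simpa using ψ.integrable_pow_mul volume 1, ?_, fun ξ hξ => ?_⟩
  · have h := hψ 0
    simpa [χ.one_of_mem_closedBall (Metric.mem_closedBall_self χ.rIn_pos.le)] using h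
  · have h := hψ (-(2 * Real.pi)⁻¹ • ξ)
    rw [χ.zero_of_le_dist, Complex.ofReal_zero] at h
    · rw [← h]
      refine integral_congr_ae (.of_forall fun w => ?_)
      simp only [smul_eq_mul]
      congr 2
      rw [mul_comm, inner_smul_right, real_inner_comm]
      congr 2
      field_simp
    · rw [dist_zero_right, norm_smul, norm_neg, Real.norm_of_nonneg (by positivity)]
      exact le_mul_of_one_le_right (by positivity) hξ

lemma clm_apply_eq_add (L : ℂ →L[ℝ] ℂ) (ω : ℂ) :
    L ω = ω * (L 1 - Complex.I * L Complex.I) + Complex.I * L (Complex.I * ω) := by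
  have h : ∀ z : ℂ, L z = z.re * L 1 + z.im * L Complex.I := fun z => by
    have hz : z = z.re • (1 : ℂ) + z.im • Complex.I := by
      simp [Complex.re_add_im]
    conv_lhs => rw [hz, map_add, map_smul, map_smul, Complex.real_smul, Complex.real_smul]
  have hω := Complex.re_add_im ω
  rw [h ω, h (Complex.I * ω)]
  simp only [Complex.mul_re, Complex.mul_im, Complex.I_re, Complex.I_im, zero_mul, one_mul,
    zero_sub, zero_add, Complex.ofReal_neg]
  linear_combination (L 1 - Complex.I * L Complex.I) * hω +
    ω.im * L Complex.I * Complex.I_sq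

lemma hasDerivAt_exp_I_mul_ofReal (θ : ℝ) :
    HasDerivAt (fun θ : ℝ => Complex.exp (Complex.I * θ))
      (Complex.I * Complex.exp (Complex.I * θ)) θ := by
  have h := ((hasDerivAt_id' θ).ofReal_comp.const_mul Complex.I).cexp
  rwa [Complex.ofReal_one, mul_one, mul_comm] at h

lemma exp_I_mul_two_pi : Complex.exp (Complex.I * (2 * Real.pi : ℝ)) = 1 := by
  rw [Complex.exp_eq_one_iff]
  exact ⟨1, by push_cast; ring⟩

/-- The angular derivative of a function integrates to zero along circles. -/
lemma integral_angular_fderiv_eq_zero {v : ℂ → ℂ} (hv : ContDiff ℝ 1 v) (w : ℂ) (t : ℝ) :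
    ∫ θ in (0 : ℝ)..2 * Real.pi, fderiv ℝ v (t • (Complex.exp (Complex.I * θ) * w))
      (Complex.I * (Complex.exp (Complex.I * θ) * w)) = 0 := by
  have hcont : Continuous fun θ : ℝ => fderiv ℝ v (t • (Complex.exp (Complex.I * θ) * w))
      (Complex.I * (Complex.exp (Complex.I * θ) * w)) :=
    ((hv.continuous_fderiv one_ne_zero).comp (by fun_prop)).clm_apply (by fun_prop)
  have hω : ∀ θ : ℝ, HasDerivAt (fun θ : ℝ => Complex.exp (Complex.I * θ) * w)
      (Complex.I * (Complex.exp (Complex.I * θ) * w)) θ := fun θ => by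
    rw [← mul_assoc]
    exact (hasDerivAt_exp_I_mul_ofReal θ).mul_const w
  rcases eq_or_ne t 0 with rfl | ht
  · simp only [zero_smul] at hcont ⊢
    rw [intervalIntegral.integral_eq_sub_of_hasDerivAt
      (fun θ _ => (fderiv ℝ v 0).hasFDerivAt.comp_hasDerivAt θ (hω θ))
      (hcont.intervalIntegrable _ _)]
    simp [exp_I_mul_two_pi, -Complex.ofReal_mul]
  · have hωt : ∀ θ : ℝ, HasDerivAt (fun θ : ℝ => t • (Complex.exp (Complex.I * θ) * w))
        (t • (Complex.I * (Complex.exp (Complex.I * θ) * w))) θ := fun θ => (hω θ).const_smul t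
    have hint : IntervalIntegrable (fun θ : ℝ =>
        fderiv ℝ v (t • (Complex.exp (Complex.I * θ) * w))
          (t • (Complex.I * (Complex.exp (Complex.I * θ) * w)))) volume 0 (2 * Real.pi) := by
      simp only [map_smul]
      exact (hcont.const_smul t).intervalIntegrable _ _
    have h := intervalIntegral.integral_eq_sub_of_hasDerivAt (fun θ _ =>
      (hv.differentiable one_ne_zero _).hasFDerivAt.comp_hasDerivAt θ (hωt θ)) hint
    simp only [map_smul, intervalIntegral.integral_smul] at h
    refine (smul_eq_zero.mp (h.trans ?_)).resolve_left ht
    simp [exp_I_mul_two_pi, -Complex.ofReal_mul]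

/-- A bound on `∂ₓv - i ∂ᵧv` controls the deviation of circular means from the central value. -/
lemma norm_integral_circle_sub_le {v : ℂ → ℂ} (hv : ContDiff ℝ 1 v) {G : ℝ}
    (hG : ∀ ζ, ‖fderiv ℝ v ζ 1 - Complex.I * fderiv ℝ v ζ Complex.I‖ ≤ G) (w : ℂ) :
    ‖(∫ θ in (0 : ℝ)..2 * Real.pi, v (Complex.exp (Complex.I * θ) * w)) -
      (2 * Real.pi : ℝ) • v 0‖ ≤ 2 * Real.pi * G * ‖w‖ := by
  let ω : ℝ → ℂ := fun θ => Complex.exp (Complex.I * θ) * w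
  have hωc : Continuous ω := by fun_prop
  have hωn : ∀ θ, ‖ω θ‖ = ‖w‖ := fun θ => by
    simp only [ω, norm_mul]
    rw [mul_comm Complex.I, Complex.norm_exp_ofReal_mul_I, one_mul]
  let J' : ℝ → ℝ → ℂ := fun t θ => fderiv ℝ v (t • ω θ) (ω θ)
  have hJ'c : ∀ t, Continuous (J' t) := fun t =>
    ((hv.continuous_fderiv one_ne_zero).comp (hωc.const_smul t)).clm_apply hωc
  have hderiv : ∀ t : ℝ, HasDerivAt (fun t : ℝ => ∫ θ in (0 : ℝ)..2 * Real.pi, v (t • ω θ))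
      (∫ θ in (0 : ℝ)..2 * Real.pi, J' t θ) t := fun t => by
    obtain ⟨C, hC⟩ := (isCompact_closedBall (0 : ℂ) ((|t| + 1) * ‖w‖)).exists_bound_of_continuousOn
      (hv.continuous_fderiv one_ne_zero).continuousOn
    refine (intervalIntegral.hasDerivAt_integral_of_dominated_loc_of_deriv_le
      (F := fun t θ => v (t • ω θ)) (F' := J') (bound := fun _ => C * ‖w‖)
      (Metric.ball_mem_nhds t one_pos)
      (.of_forall fun s => (hv.continuous.comp (hωc.const_smul s)).aestronglyMeasurable)
      ((hv.continuous.comp (hωc.const_smul t)).intervalIntegrable _ _)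
      (hJ'c t).aestronglyMeasurable (.of_forall fun θ _ s hs => ?_)
      intervalIntegrable_const (.of_forall fun θ _ s _ => ?_)).2
    · refine (ContinuousLinearMap.le_opNorm _ _).trans ?_
      rw [hωn]
      gcongr
      refine hC _ ?_
      rw [mem_closedBall_zero_iff, norm_smul, hωn]
      gcongr
      have := abs_sub_abs_le_abs_sub s t
      rw [Metric.mem_ball, Real.dist_eq] at hs
      rw [Real.norm_eq_abs]
      linarith
    · have h := (hasDerivAt_id' s).smul_const (ω θ)
      rw [one_smul] at h
      exact (hv.differentiable one_ne_zero _).hasFDerivAt.comp_hasDerivAt s h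
  have hbound : ∀ t : ℝ, ‖∫ θ in (0 : ℝ)..2 * Real.pi, J' t θ‖ ≤ 2 * Real.pi * G * ‖w‖ :=
      fun t => by
    let A : ℝ → ℂ := fun θ => ω θ * (fderiv ℝ v (t • ω θ) 1 -
      Complex.I * fderiv ℝ v (t • ω θ) Complex.I)
    let K : ℝ → ℂ := fun θ => fderiv ℝ v (t • ω θ) (Complex.I * ω θ)
    have hD : Continuous fun θ => fderiv ℝ v (t • ω θ) :=
      (hv.continuous_fderiv one_ne_zero).comp (hωc.const_smul t)
    have hA : Continuous A := hωc.mul ((hD.clm_apply continuous_const).sub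
      (continuous_const.mul (hD.clm_apply continuous_const)))
    have hK : Continuous K := hD.clm_apply (continuous_const.mul hωc)
    have hIK : Continuous fun θ => Complex.I * K θ := continuous_const.mul hK
    have hsplit : J' t = fun θ => A θ + Complex.I * K θ :=
      funext fun θ => clm_apply_eq_add _ _
    simp only [hsplit]
    rw [intervalIntegral.integral_add (hA.intervalIntegrable _ _)
      (hIK.intervalIntegrable _ _), intervalIntegral.integral_const_mul,
      integral_angular_fderiv_eq_zero hv w t, mul_zero, add_zero]
    refine (intervalIntegral.norm_integral_le_of_norm_le_const (C := ‖w‖ * G)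
      fun θ _ => ?_).trans_eq ?_
    · rw [norm_mul, hωn]
      gcongr
      exact hG _
    · rw [sub_zero, abs_of_pos Real.two_pi_pos]
      ring
  have h := norm_image_sub_le_of_norm_deriv_le_segment_01'
    (fun t _ => (hderiv t).hasDerivWithinAt) (fun t _ => hbound t)
  simpa [ω] using h

/-- The inclusion of the horizontal plane, identified with `ℂ`, into `ℝ³`. -/
def horizontal : ℂ →L[ℝ] (Fin 3 → ℝ) :=
  ContinuousLinearMap.pi ![Complex.reCLM, Complex.imCLM, 0]

lemma horizontal_one : horizontal 1 = Pi.single 0 1 := by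
  ext i
  fin_cases i <;> simp [horizontal]

lemma horizontal_I : horizontal Complex.I = Pi.single 1 1 := by
  ext i
  fin_cases i <;> simp [horizontal]

lemma phase_horizontal (k : (ℤ × ℤ) × ℤ) (w : ℂ) :
    phase k (horizontal w) = inner ℝ (⟨k.1.1, k.1.2⟩ : ℂ) w := by
  simp [phase_apply, horizontal, Complex.inner, mul_comm]

lemma norm_eq_knorm (k : ℤ × ℤ) : ‖(⟨k.1, k.2⟩ : ℂ)‖ = knorm k := by
  rw [knorm, Complex.norm_eq_sqrt_sq_add_sq]

lemma RapidDecay.norm_trigSeries_le {a : (ℤ × ℤ) × ℤ → ℂ} (ha : RapidDecay a)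
    (x : Fin 3 → ℝ) : ‖trigSeries a x‖ ≤ ∑' k, ‖a k‖ := by
  refine tsum_of_norm_bounded ha.summable_norm.hasSum fun k => ?_
  rw [norm_mul, norm_planeWave, mul_one]

/-- Pairing a high-frequency series with a band-limited kernel gives zero. -/
lemma RapidDecay.integral_kernel_mul_trigSeries_eq_zero {a : (ℤ × ℤ) × ℤ → ℂ}
    (ha : RapidDecay a) {lam : ℝ} (hlam : 0 < lam) (hsupp : ∀ k, a k ≠ 0 → lam ≤ knorm k.1)
    {ψ : ℂ → ℂ} (hψ : Integrable ψ)
    (hband : ∀ ξ : ℂ, 1 ≤ ‖ξ‖ → ∫ w, Complex.exp (Complex.I * (inner ℝ ξ w : ℝ)) * ψ w = 0)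
    (x : Fin 3 → ℝ) {c : ℂ} (hc : ‖c‖ = 1) :
    ∫ w, ψ w * trigSeries a (x + horizontal (lam⁻¹ • (c * w))) = 0 := by
  have hterm : ∀ k, ∫ w, ψ w * (a k * planeWave k (x + horizontal (lam⁻¹ • (c * w)))) = 0 :=
      fun k => by
    by_cases hk : a k = 0
    · simp [hk]
    have hξ : 1 ≤ ‖lam⁻¹ • (starRingEnd ℂ c * (⟨k.1.1, k.1.2⟩ : ℂ))‖ := by
      rw [norm_smul, norm_mul, RCLike.norm_conj, hc, one_mul, norm_eq_knorm,
        Real.norm_of_nonneg (by positivity), ← div_eq_inv_mul, le_div_iff₀ hlam, one_mul]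
      exact hsupp k hk
    have hw : ∀ w, ψ w * (a k * planeWave k (x + horizontal (lam⁻¹ • (c * w)))) =
        a k * planeWave k x * (Complex.exp (Complex.I *
          (inner ℝ (lam⁻¹ • (starRingEnd ℂ c * (⟨k.1.1, k.1.2⟩ : ℂ))) w : ℝ)) * ψ w) := fun w => by
      have hin : inner ℝ (⟨k.1.1, k.1.2⟩ : ℂ) (lam⁻¹ • (c * w)) =
          inner ℝ (lam⁻¹ • (starRingEnd ℂ c * (⟨k.1.1, k.1.2⟩ : ℂ))) w := by
        rw [inner_smul_left, inner_smul_right, Complex.inner, Complex.inner, map_mul,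
          Complex.conj_conj]
        congr 2
        ring
      rw [planeWave_add, planeWave.eq_1 k (horizontal _), phase_horizontal, hin]
      ring
    simp only [hw]
    rw [integral_const_mul, hband _ hξ, mul_zero]
  have hcont : ∀ k, Continuous fun w => a k * planeWave k (x + horizontal (lam⁻¹ • (c * w))) :=
    fun k => continuous_const.mul ((contDiff_planeWave k (n := 0)).continuous.comp (by fun_prop))
  have hnorm : ∀ k w, ‖a k * planeWave k (x + horizontal (lam⁻¹ • (c * w)))‖ = ‖a k‖ :=
    fun k w => by rw [norm_mul, norm_planeWave, mul_one]
  have h := hasSum_integral_of_summable_integral_norm (μ := volume)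
    (F := fun k w => ψ w * (a k * planeWave k (x + horizontal (lam⁻¹ • (c * w)))))
    (fun k => hψ.mul_bdd (hcont k).aestronglyMeasurable (.of_forall fun w => (hnorm k w).le))
    (by
      simp only [norm_mul, norm_planeWave, mul_one, integral_mul_const]
      exact ha.summable_norm.mul_left _)
  simp only [hterm, tsum_mul_left] at h
  exact h.unique hasSum_zero

/-- A high-frequency series is controlled by `λ⁻¹` times its horizontal `∂`-derivative. -/
lemma exists_norm_trigSeries_le :
    ∃ C : ℝ, 0 ≤ C ∧ ∀ a : (ℤ × ℤ) × ℤ → ℂ, RapidDecay a → ∀ lam : ℝ, 0 < lam →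
      (∀ k, a k ≠ 0 → lam ≤ knorm k.1) → ∀ G : ℝ,
      (∀ y, ‖fderiv ℝ (trigSeries a) y (Pi.single 0 1) -
        Complex.I * fderiv ℝ (trigSeries a) y (Pi.single 1 1)‖ ≤ G) →
      ∀ x, ‖trigSeries a x‖ ≤ C * lam⁻¹ * G := by
  obtain ⟨ψ, hψ, hψ1, hmass, hband⟩ := exists_bandlimited_kernel
  refine ⟨∫ w, ‖w‖ * ‖ψ w‖, integral_nonneg fun w => by positivity,
    fun a ha lam hlam hsupp G hG x => ?_⟩
  let v : ℂ → ℂ := fun ζ => trigSeries a (x + horizontal (lam⁻¹ • ζ))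
  have hu := ha.contDiff
  have hv : ContDiff ℝ 1 v := (hu.of_le (by simp)).comp (by fun_prop)
  have hdv : ∀ ζ η, fderiv ℝ v ζ η =
      lam⁻¹ • fderiv ℝ (trigSeries a) (x + horizontal (lam⁻¹ • ζ)) (horizontal η) := fun ζ η => by
    have h1 : HasFDerivAt (fun ζ => x + horizontal (lam⁻¹ • ζ)) (lam⁻¹ • horizontal) ζ := by
      refine (((lam⁻¹ • horizontal).hasFDerivAt (x := ζ)).const_add x).congr_of_eventuallyEq
        (.of_forall fun z => ?_)
      change x + horizontal (lam⁻¹ • z) = x + lam⁻¹ • horizontal z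
      rw [map_smul]
    have h2 : HasFDerivAt (trigSeries a ∘ fun ζ => x + horizontal (lam⁻¹ • ζ))
        ((fderiv ℝ (trigSeries a) (x + horizontal (lam⁻¹ • ζ))).comp (lam⁻¹ • horizontal)) ζ :=
      HasFDerivAt.comp ζ (hu.differentiable (by simp) _).hasFDerivAt h1
    change fderiv ℝ (trigSeries a ∘ fun ζ => x + horizontal (lam⁻¹ • ζ)) ζ η = _
    rw [h2.fderiv, ContinuousLinearMap.comp_apply, _root_.smul_apply, map_smul]
  have hvG : ∀ ζ, ‖fderiv ℝ v ζ 1 - Complex.I * fderiv ℝ v ζ Complex.I‖ ≤ lam⁻¹ * G :=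
      fun ζ => by
    rw [hdv, hdv, horizontal_one, horizontal_I, mul_smul_comm, ← smul_sub, norm_smul,
      Real.norm_of_nonneg (by positivity)]
    gcongr
    exact hG _
  let J : ℂ → ℂ := fun w => ∫ θ in (0 : ℝ)..2 * Real.pi, v (Complex.exp (Complex.I * θ) * w)
  have hJ : ∀ w, ‖J w - (2 * Real.pi : ℝ) • v 0‖ ≤ 2 * Real.pi * (lam⁻¹ * G) * ‖w‖ :=
    norm_integral_circle_sub_le hv hvG
  have hint : Integrable (Function.uncurry fun (θ : ℝ) (w : ℂ) =>
      ψ w * v (Complex.exp (Complex.I * θ) * w))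
      ((volume.restrict (Set.uIoc 0 (2 * Real.pi))).prod volume) := by
    have : IsFiniteMeasure (volume.restrict (Set.uIoc 0 (2 * Real.pi))) := by
      rw [Set.uIoc]
      infer_instance
    have hc : Continuous fun p : ℝ × ℂ => v (Complex.exp (Complex.I * p.1) * p.2) :=
      hv.continuous.comp (by fun_prop)
    exact (hψ.comp_snd _).mul_bdd (c := ∑' k, ‖a k‖) hc.aestronglyMeasurable
      (.of_forall fun p => ha.norm_trigSeries_le _)
  have hswap := intervalIntegral_integral_swap hint
  have hzero : ∫ w, ψ w * J w = 0 := by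
    simp only [intervalIntegral.integral_const_mul] at hswap
    rw [← hswap]
    have : ∀ θ : ℝ, ∫ w, ψ w * v (Complex.exp (Complex.I * θ) * w) = 0 := fun θ =>
      ha.integral_kernel_mul_trigSeries_eq_zero hlam hsupp hψ hband x
        (by rw [mul_comm, Complex.norm_exp_ofReal_mul_I])
    simp [this]
  have hJint : Integrable fun w => ψ w * J w := by
    have h := hint.integral_prod_right
    refine h.congr (.of_forall fun w => ?_)
    simp only [Function.uncurry, J]
    rw [intervalIntegral.integral_of_le Real.two_pi_pos.le,
      Set.uIoc_of_le Real.two_pi_pos.le, integral_const_mul]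
  have hv0 : v 0 = trigSeries a x := by simp [v]
  have hrep : (2 * Real.pi : ℝ) • trigSeries a x =
      -∫ w, ψ w * (J w - (2 * Real.pi : ℝ) • v 0) := by
    simp only [mul_sub]
    rw [integral_sub hJint (hψ.mul_const _), hzero, integral_mul_const, hmass, hv0]
    ring
  have hle : ‖(2 * Real.pi : ℝ) • trigSeries a x‖ ≤
      2 * Real.pi * ((∫ w, ‖w‖ * ‖ψ w‖) * lam⁻¹ * G) := by
    rw [hrep, norm_neg]
    refine (norm_integral_le_of_norm_le (hψ1.const_mul (2 * Real.pi * (lam⁻¹ * G)))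
      (.of_forall fun w => ?_)).trans_eq ?_
    · rw [norm_mul]
      calc _ ≤ ‖ψ w‖ * (2 * Real.pi * (lam⁻¹ * G) * ‖w‖) := by gcongr; exact hJ w
        _ = _ := by ring
    · rw [integral_const_mul]
      ring
  rw [norm_smul, Real.norm_of_nonneg Real.two_pi_pos.le] at hle
  exact le_of_mul_le_mul_left hle Real.two_pi_pos

/-! ### The inverse divergence -/

/-- The Fourier multiplier `(k₁ + i k₂)² / |k̄|²`, which inverts `∂ₓ - i ∂ᵧ` against
`∂ₓ + i ∂ᵧ`. -/
def beurlingSymbol (k : (ℤ × ℤ) × ℤ) : ℂ :=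
  ((k.1.1 : ℂ) + Complex.I * k.1.2) / ((k.1.1 : ℂ) - Complex.I * k.1.2)

lemma norm_beurlingSymbol_le_one (k : (ℤ × ℤ) × ℤ) : ‖beurlingSymbol k‖ ≤ 1 := by
  have h : (starRingEnd ℂ) ((k.1.1 : ℂ) + Complex.I * k.1.2) =
      (k.1.1 : ℂ) - Complex.I * k.1.2 := by
    simp [sub_eq_add_neg]
  rw [beurlingSymbol, ← h, norm_div, RCLike.norm_conj]
  exact div_self_le_one _

lemma beurlingSymbol_mul (k : (ℤ × ℤ) × ℤ) :
    ((k.1.1 : ℂ) - Complex.I * k.1.2) * beurlingSymbol k = (k.1.1 : ℂ) + Complex.I * k.1.2 := by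
  by_cases h : (k.1.1 : ℂ) - Complex.I * k.1.2 = 0
  · have hre := congrArg Complex.re h
    have him := congrArg Complex.im h
    simp at hre him
    simp [hre, him]
  · exact mul_div_cancel₀ _ h

lemma beurlingSymbol_of_horizontal_eq_zero {k : (ℤ × ℤ) × ℤ} (hk : k.1 = 0) :
    beurlingSymbol k = 0 := by
  simp [beurlingSymbol, hk]

lemma RapidDecay.fderiv_beurling {a : (ℤ × ℤ) × ℤ → ℂ} (ha : RapidDecay a) (x : Fin 3 → ℝ)
    (hb : RapidDecay fun k => beurlingSymbol k * a k) :
    fderiv ℝ (trigSeries fun k => beurlingSymbol k * a k) x (Pi.single 0 1) -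
      Complex.I * fderiv ℝ (trigSeries fun k => beurlingSymbol k * a k) x (Pi.single 1 1) =
    fderiv ℝ (trigSeries a) x (Pi.single 0 1) +
      Complex.I * fderiv ℝ (trigSeries a) x (Pi.single 1 1) := by
  simp only [hb.fderiv_trigSeries_single, ha.fderiv_trigSeries_single]
  simp only [trigSeries, ← tsum_mul_left]
  rw [← ((hb.deriv 0).summable x).tsum_sub (((hb.deriv 1).summable x).mul_left _),
    ← ((ha.deriv 0).summable x).tsum_add (((ha.deriv 1).summable x).mul_left _)]
  refine tsum_congr fun k => ?_
  have h := beurlingSymbol_mul k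
  simp only [coeffDeriv, freqComp, Fin.isValue, Matrix.cons_val_zero, Matrix.cons_val_one]
  linear_combination Complex.I * a k * planeWave k x * h

lemma fderiv_ofReal_comp {f : (Fin 3 → ℝ) → ℝ} (hf : Differentiable ℝ f) (x v : Fin 3 → ℝ) :
    fderiv ℝ (fun y => (f y : ℂ)) x v = fderiv ℝ f x v := by
  have h : HasFDerivAt (fun y => (f y : ℂ)) (Complex.ofRealCLM.comp (fderiv ℝ f x)) x :=
    Complex.ofRealCLM.hasFDerivAt.comp x (hf x).hasFDerivAt
  rw [h.fderiv]
  rfl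

lemma pd3_re {u : (Fin 3 → ℝ) → ℂ} (hu : Differentiable ℝ u) (i : Fin 3) (x : Fin 3 → ℝ) :
    pd3 i (fun y => (u y).re) x = (fderiv ℝ u x (Pi.single i 1)).re := by
  have h : HasFDerivAt (fun y => (u y).re) (Complex.reCLM.comp (fderiv ℝ u x)) x :=
    Complex.reCLM.hasFDerivAt.comp x (hu x).hasFDerivAt
  rw [pd3, h.fderiv]
  rfl

lemma pd3_im {u : (Fin 3 → ℝ) → ℂ} (hu : Differentiable ℝ u) (i : Fin 3) (x : Fin 3 → ℝ) :
    pd3 i (fun y => (u y).im) x = (fderiv ℝ u x (Pi.single i 1)).im := by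
  have h : HasFDerivAt (fun y => (u y).im) (Complex.imCLM.comp (fderiv ℝ u x)) x :=
    Complex.imCLM.hasFDerivAt.comp x (hu x).hasFDerivAt
  rw [pd3, h.fderiv]
  rfl

lemma pd3_neg (f : (Fin 3 → ℝ) → ℝ) (i : Fin 3) (x : Fin 3 → ℝ) :
    pd3 i (fun y => -f y) x = -pd3 i f x := by
  rw [pd3, fderiv_fun_neg]
  rfl

/-- The traceless symmetric matrix with first row `(Re z, Im z)`. -/
def tracelessSymm (z : ℂ) : Fin 2 → Fin 2 → ℝ := ![![z.re, z.im], ![z.im, -z.re]]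

lemma contDiff_tracelessSymm {n : WithTop ℕ∞} : ContDiff ℝ n tracelessSymm := by
  have hre : ContDiff ℝ n Complex.re := Complex.reCLM.contDiff
  have him : ContDiff ℝ n Complex.im := Complex.imCLM.contDiff
  refine contDiff_pi.2 fun i => contDiff_pi.2 fun j => ?_
  fin_cases i <;> fin_cases j
  exacts [hre, him, him, hre.neg]

lemma norm_tracelessSymm_le (z : ℂ) : ‖tracelessSymm z‖ ≤ ‖z‖ := by
  refine (pi_norm_le_iff_of_nonneg (norm_nonneg z)).2 fun i =>
    (pi_norm_le_iff_of_nonneg (norm_nonneg z)).2 fun j => ?_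
  have hre := Complex.abs_re_le_norm z
  have him := Complex.abs_im_le_norm z
  fin_cases i <;> fin_cases j <;> simpa [tracelessSymm]

/-- **Inverse horizontal divergence of a horizontal gradient.**
If `f` has zero mean on every horizontal slice and all its nonzero Fourier modes have
horizontal frequency at least `λ`, then there is a symmetric traceless `2×2` matrix field
`E` with `∇̄ · E = ∇̄ f` (row by row) and `‖E‖_{C⁰} ≤ C λ⁻¹ ‖∇̄ f‖_{C⁰}`. -/
theorem inverse_divergence_of_gradient :
    ∃ C : ℝ, 0 < C ∧
      ∀ f : (Fin 3 → ℝ) → ℝ, ContDiff ℝ (⊤ : ℕ∞) f → Periodic3 f →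
        (∀ z : ℝ, (∫ y in box2, f ![y 0, y 1, z]) = 0) →
        ∀ lam : ℝ, 0 < lam →
        (∀ k : (ℤ × ℤ) × ℤ, k ≠ 0 → fc3 (fun x => (f x : ℂ)) k ≠ 0 → lam ≤ knorm k.1) →
        ∃ E : (Fin 3 → ℝ) → Fin 2 → Fin 2 → ℝ,
          ContDiff ℝ (⊤ : ℕ∞) E ∧ Periodic3 E ∧
          -- symmetric
          (∀ x, E x 0 1 = E x 1 0) ∧
          -- traceless
          (∀ x, E x 0 0 + E x 1 1 = 0) ∧
          -- ∇̄ · E = ∇̄ f, row by row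
          (∀ x (i : Fin 2),
            (∑ j : Fin 2, pd3 j.castSucc (fun y => E y i j) x) = pd3 i.castSucc f x) ∧
          -- C⁰ bound
          (∀ x, ‖E x‖ ≤ C * lam⁻¹ * ⨆ y, ‖(fun i : Fin 2 => pd3 i.castSucc f y)‖) := by
  obtain ⟨C, hC, hbound⟩ := exists_norm_trigSeries_le
  refine ⟨2 * C + 1, by positivity, fun f hf hfp _ lam hlam hsupp => ?_⟩
  let F : (Fin 3 → ℝ) → ℂ := fun x => (f x : ℂ)
  have hF : ContDiff ℝ (⊤ : ℕ∞) F := Complex.ofRealCLM.contDiff.comp hf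
  have hFp : Periodic3 F := fun x i => congrArg Complex.ofReal (hfp x i)
  have ha := rapidDecay_fc3 hF hFp
  have hFs := eq_trigSeries_fc3 hF hFp
  have hb : RapidDecay fun k => beurlingSymbol k * fc3 F k :=
    ha.mul fun k => (norm_beurlingSymbol_le_one k).trans (one_le_freqWeight k)
  let u := trigSeries fun k => beurlingSymbol k * fc3 F k
  have hu : ContDiff ℝ (⊤ : ℕ∞) u := hb.contDiff
  have hud : Differentiable ℝ u := hu.differentiable (by simp)
  have hdF : ∀ y i, fderiv ℝ F y (Pi.single i 1) = (pd3 i f y : ℂ) := fun y i =>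
    fderiv_ofReal_comp (hf.differentiable (by simp)) _ _
  have heq : ∀ y, fderiv ℝ u y (Pi.single 0 1) - Complex.I * fderiv ℝ u y (Pi.single 1 1) =
      (pd3 0 f y : ℂ) + Complex.I * pd3 1 f y := fun y => by
    rw [← hdF, ← hdF, hFs]
    exact ha.fderiv_beurling y hb
  have hsymb : ∀ k, beurlingSymbol k * fc3 F k ≠ 0 → lam ≤ knorm k.1 := fun k hk => by
    refine hsupp k (fun h => hk ?_) (right_ne_zero_of_mul hk)
    rw [beurlingSymbol_of_horizontal_eq_zero (by simp [h]), zero_mul]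
  have hbdd : BddAbove (Set.range fun y => ‖(fun i : Fin 2 => pd3 i.castSucc f y)‖) := by
    refine ⟨∑ i : Fin 3, ∑' k, ‖coeffDeriv i (fc3 F) k‖, ?_⟩
    rintro _ ⟨y, rfl⟩
    have hi : ∀ i : Fin 3, ‖pd3 i f y‖ ≤ ∑' k, ‖coeffDeriv i (fc3 F) k‖ := fun i => by
      rw [← Complex.norm_real, ← hdF, hFs, ha.fderiv_trigSeries_single]
      rw [← hFs]
      exact (ha.deriv i).norm_trigSeries_le y
    refine (pi_norm_le_iff_of_nonneg (by positivity)).2 fun i => (hi _).trans ?_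
    exact Finset.single_le_sum (f := fun i => ∑' k, ‖coeffDeriv i (fc3 F) k‖)
      (fun _ _ => tsum_nonneg fun _ => norm_nonneg _) (Finset.mem_univ _)
  set S := ⨆ y, ‖(fun i : Fin 2 => pd3 i.castSucc f y)‖ with hS
  have hle : ∀ y (i : Fin 2), ‖pd3 i.castSucc f y‖ ≤ S := fun y i =>
    (norm_le_pi_norm (fun i : Fin 2 => pd3 i.castSucc f y) i).trans (le_ciSup hbdd y)
  have hS0 : 0 ≤ S := (norm_nonneg _).trans (hle 0 0)
  have hG : ∀ y, ‖fderiv ℝ u y (Pi.single 0 1) - Complex.I * fderiv ℝ u y (Pi.single 1 1)‖ ≤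
      2 * S := fun y => by
    rw [heq]
    refine (norm_add_le _ _).trans ?_
    rw [norm_mul, Complex.norm_I, one_mul, Complex.norm_real, Complex.norm_real, two_mul]
    exact add_le_add (hle y 0) (hle y 1)
  refine ⟨fun x => tracelessSymm (u x), contDiff_tracelessSymm.comp hu,
    fun x i => congrArg tracelessSymm (trigSeries_periodic _ x i), fun x => rfl,
    fun x => add_neg_cancel _, fun x i => ?_, fun x => ?_⟩
  · have hre := congrArg Complex.re (heq x)
    have him := congrArg Complex.im (heq x)
    simp at hre him
    rw [Fin.sum_univ_two]
    fin_cases i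
    · refine Eq.trans ?_ hre
      change pd3 0 (fun y => (u y).re) x + pd3 1 (fun y => (u y).im) x = _
      rw [pd3_re hud, pd3_im hud]
    · refine Eq.trans ?_ him
      change pd3 0 (fun y => (u y).im) x + pd3 1 (fun y => -(u y).re) x = _
      rw [pd3_neg, pd3_re hud, pd3_im hud]
      ring
  · calc ‖tracelessSymm (u x)‖ ≤ ‖u x‖ := norm_tracelessSymm_le _
      _ ≤ C * lam⁻¹ * (2 * S) := hbound _ hb lam hlam hsymb _ hG x
      _ = 2 * C * lam⁻¹ * S := by ring
      _ ≤ (2 * C + 1) * lam⁻¹ * S := by gcongr; linarith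

end
end

section
/- Let M be the set of 3×3 real matrices of the form [[m₁, m₂, 0], [m₃, −m₁, 0], [m₄, m₅, 0]] with m₁,…,m₅ ∈ ℝ. Then there exist matrices M₁, M₂ ∈ M, a number ε > 0, two disjoint finite subsets Ω₁, Ω₂ ⊂ ℚ³ ∩ S² (vectors of the unit sphere with rational coordinates), and, for j = 1, 2 and each k ∈ Ω_j, smooth positive functions c_{j,k} defined on the ε-ball around M_j inside M, such that: (1) each Ω_j is at positive distance from the z-axis (every k ∈ Ω_j has (k₁,k₂) ≠ (0,0)); (2) Ω_j = −Ω_j and c_{j,k} = c_{j,−k}; (3) 13k ∈ ℤ³ for every k ∈ Ω_j; (4) for j = 1, 2 and every M ∈ M with |M − M_j| < ε one has M = (1/2) Σ_{k ∈ Ω_j} (c_{j,k}(M))² k ⊗ k̄⊥, where k̄⊥ := (−k₂, k₁, 0); (5) moreover, if M = M_j + N for some N ∈ M with N₁₂ = N₂₁, then Σ_{k ∈ Ω_j} (c_{j,k}(M))² = 1. -/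
open Real

noncomputable section

/-- The space `𝓜` of `3×3` matrices of the form
`[[m₁, m₂, 0], [m₃, −m₁, 0], [m₄, m₅, 0]]`. -/
def MSet : Set (Fin 3 → Fin 3 → ℝ) :=
  {A | A 0 2 = 0 ∧ A 1 2 = 0 ∧ A 2 2 = 0 ∧ A 1 1 = -A 0 0}

/-- `k̄⊥ = (−k₂, k₁, 0)` for `k = (k₁,k₂,k₃)`. -/
def kperp (k : Fin 3 → ℝ) : Fin 3 → ℝ := ![-(k 1), k 0, 0]

/-- The vectors `(±p, ±q, ±h) / 13` and `(±q, ±p, ±h) / 13`, indexed by a swap and three signs. -/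
def frequency (p q h : ℤ) (t : Bool × ℤˣ × ℤˣ × ℤˣ) : Fin 3 → ℝ := fun i =>
  ((![t.2.1 * (if t.1 then p else q), t.2.2.1 * (if t.1 then q else p), t.2.2.2 * h] i : ℤ) : ℝ)
    / 13

/-- The set of all vectors `(±p, ±q, ±h) / 13` and `(±q, ±p, ±h) / 13`. -/
def frequencySet (p q h : ℤ) : Finset (Fin 3 → ℝ) :=
  Finset.univ.image (frequency p q h)

/-- The weight of the frequency `k` in the decomposition of the matrix `A`. It is the expansion of
`A` in the functions `1`, `k₁² - k₂²`, `k₁ k₂`, `k₃ k₁`, `k₃ k₂`, which are orthogonal on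
`frequencySet p q h`. -/
def weight (p q h : ℝ) (k : Fin 3 → ℝ) (A : Fin 3 → Fin 3 → ℝ) : ℝ :=
  169 * ((A 0 1 - A 1 0) / (8 * (p ^ 2 + q ^ 2))
    + 169 * (A 0 1 + A 1 0) * (k 0 ^ 2 - k 1 ^ 2) / (8 * (p ^ 2 - q ^ 2) ^ 2)
    - 169 * A 0 0 * (k 0 * k 1) / (8 * p ^ 2 * q ^ 2)
    + 169 * (A 2 1 * (k 2 * k 0) - A 2 0 * (k 2 * k 1)) / (4 * (p ^ 2 + q ^ 2) * h ^ 2))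

/-- The matrix all of whose weights are `1 / 16`. -/
def baseMatrix (p q : ℝ) : Fin 3 → Fin 3 → ℝ :=
  ![![0, (p ^ 2 + q ^ 2) / 676, 0], ![-(p ^ 2 + q ^ 2) / 676, 0, 0], ![0, 0, 0]]

lemma baseMatrix_mem (p q : ℝ) : baseMatrix p q ∈ MSet := by
  simp [MSet, baseMatrix]

lemma neg_frequency (p q h : ℤ) (t : Bool × ℤˣ × ℤˣ × ℤˣ) :
    -frequency p q h t = frequency p q h (t.1, -t.2.1, -t.2.2.1, -t.2.2.2) := by
  obtain ⟨s, x, y, z⟩ := t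
  ext i
  cases s <;> fin_cases i <;> simp [frequency, neg_div]

lemma neg_mem_frequencySet {p q h : ℤ} {k : Fin 3 → ℝ} (hk : k ∈ frequencySet p q h) :
    -k ∈ frequencySet p q h := by
  obtain ⟨t, -, rfl⟩ := Finset.mem_image.1 hk
  rw [neg_frequency]
  exact Finset.mem_image_of_mem _ (Finset.mem_univ _)

lemma exists_int_of_mem_frequencySet {p q h : ℤ} {k : Fin 3 → ℝ} (hk : k ∈ frequencySet p q h)
    (i : Fin 3) : ∃ m : ℤ, 13 * k i = m := by
  obtain ⟨t, -, rfl⟩ := Finset.mem_image.1 hk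
  exact ⟨_, mul_div_cancel₀ _ (by norm_num)⟩

lemma units_cast_sq (x : ℤˣ) : ((x : ℤ) : ℝ) ^ 2 = 1 := by
  rcases Int.units_eq_one_or x with rfl | rfl <;> simp

lemma sq_add_sq_of_mem_frequencySet {p q h : ℤ} {k : Fin 3 → ℝ} (hk : k ∈ frequencySet p q h) :
    k 0 ^ 2 + k 1 ^ 2 = (p ^ 2 + q ^ 2) / 169 := by
  obtain ⟨⟨s, x, y, z⟩, -, rfl⟩ := Finset.mem_image.1 hk
  cases s <;> simp [frequency, mul_pow, div_pow, units_cast_sq] <;> ring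

lemma sq_of_mem_frequencySet {p q h : ℤ} {k : Fin 3 → ℝ} (hk : k ∈ frequencySet p q h) :
    k 2 ^ 2 = h ^ 2 / 169 := by
  obtain ⟨⟨s, x, y, z⟩, -, rfl⟩ := Finset.mem_image.1 hk
  simp [frequency, mul_pow, div_pow, units_cast_sq]
  norm_num

lemma frequency_injective {p q h : ℤ} (hp : p ≠ 0) (hq : q ≠ 0) (hh : h ≠ 0)
    (hpq : p ^ 2 ≠ q ^ 2) : Function.Injective (frequency p q h) := by
  have key (x x' : ℤˣ) (a b : ℤ) (hab : (x : ℤ) * a = x' * b) : a ^ 2 = b ^ 2 := by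
    have := congrArg (· ^ 2) hab
    simpa [mul_pow, ← Units.val_pow_eq_pow_val] using this
  rintro ⟨s, x, y, z⟩ ⟨s', x', y', z'⟩ hst
  have entry (i : Fin 3) := Int.cast_injective
    ((div_left_inj' (by norm_num : (13 : ℝ) ≠ 0)).1 (congrFun hst i))
  have h0 := entry 0
  have h1 := entry 1
  have h2 := entry 2
  simp only [Matrix.cons_val] at h0 h1 h2
  have hs : s = s' := by
    have := key _ _ _ _ h0
    cases s <;> cases s' <;> simp_all
  subst hs
  have hz : z = z' := Units.ext (mul_right_cancel₀ hh h2)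
  cases s <;> simp_all [Units.ext_iff]

lemma sum_frequencySet {p q h : ℤ} (hp : p ≠ 0) (hq : q ≠ 0) (hh : h ≠ 0)
    (hpq : p ^ 2 ≠ q ^ 2) (f : (Fin 3 → ℝ) → ℝ) :
    ∑ k ∈ frequencySet p q h, f k = ∑ t, f (frequency p q h t) :=
  Finset.sum_image (frequency_injective hp hq hh hpq).injOn

lemma sum_weight {p q h : ℤ} (hp : p ≠ 0) (hq : q ≠ 0) (hh : h ≠ 0) (hpq : p ^ 2 ≠ q ^ 2)
    (A : Fin 3 → Fin 3 → ℝ) :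
    ∑ k ∈ frequencySet p q h, weight p q h k A = 338 * (A 0 1 - A 1 0) / (p ^ 2 + q ^ 2) := by
  rw [sum_frequencySet hp hq hh hpq]
  have hr : (p : ℝ) ^ 2 + (q : ℝ) ^ 2 ≠ 0 := by
    have : (p : ℝ) ≠ 0 := by exact_mod_cast hp
    positivity
  simp [Fintype.sum_prod_type, UnitsInt.univ, frequency, weight]
  rw [mul_comm (8 : ℝ), ← div_div]
  ring

lemma sum_quadratic_mul (p q h : ℤ) (α β γ δ η : ℝ) (i l : Fin 3) :
    ∑ t, (fun k : Fin 3 → ℝ => (α + β * (k 0 ^ 2 - k 1 ^ 2) + γ * (k 0 * k 1) + δ * (k 2 * k 0)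
      + η * (k 2 * k 1)) * (k i * kperp k l)) (frequency p q h t) =
    ![![-16 * γ * p ^ 2 * q ^ 2 / 13 ^ 4,
        8 * α * (p ^ 2 + q ^ 2) / 13 ^ 2 + 8 * β * (p ^ 2 - q ^ 2) ^ 2 / 13 ^ 4, 0],
      ![-8 * α * (p ^ 2 + q ^ 2) / 13 ^ 2 + 8 * β * (p ^ 2 - q ^ 2) ^ 2 / 13 ^ 4,
        16 * γ * p ^ 2 * q ^ 2 / 13 ^ 4, 0],
      ![-8 * η * h ^ 2 * (p ^ 2 + q ^ 2) / 13 ^ 4, 8 * δ * h ^ 2 * (p ^ 2 + q ^ 2) / 13 ^ 4, 0]]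
      i l := by
  fin_cases i <;> fin_cases l <;>
    simp [Fintype.sum_prod_type, UnitsInt.univ, frequency, kperp] <;> ring

lemma sum_weight_mul {p q h : ℤ} (hp : p ≠ 0) (hq : q ≠ 0) (hh : h ≠ 0) (hpq : p ^ 2 ≠ q ^ 2)
    {A : Fin 3 → Fin 3 → ℝ} (hA : A ∈ MSet) (i l : Fin 3) :
    ∑ k ∈ frequencySet p q h, weight p q h k A * (k i * kperp k l) = 2 * A i l := by
  obtain ⟨h1, h2, h3, h4⟩ := hA
  have hp' : (p : ℝ) ≠ 0 := by exact_mod_cast hp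
  have hq' : (q : ℝ) ≠ 0 := by exact_mod_cast hq
  have hh' : (h : ℝ) ≠ 0 := by exact_mod_cast hh
  have hpq' : (p : ℝ) ^ 2 - q ^ 2 ≠ 0 := sub_ne_zero.2 (by exact_mod_cast hpq)
  have hr : (p : ℝ) ^ 2 + q ^ 2 ≠ 0 := by positivity
  rw [sum_frequencySet hp hq hh hpq]
  convert sum_quadratic_mul p q h (169 * (A 0 1 - A 1 0) / (8 * (p ^ 2 + q ^ 2)))
    (169 ^ 2 * (A 0 1 + A 1 0) / (8 * (p ^ 2 - q ^ 2) ^ 2))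
    (-169 ^ 2 * A 0 0 / (8 * p ^ 2 * q ^ 2))
    (169 ^ 2 * A 2 1 / (4 * (p ^ 2 + q ^ 2) * h ^ 2))
    (-169 ^ 2 * A 2 0 / (4 * (p ^ 2 + q ^ 2) * h ^ 2)) i l using 2
  · unfold weight
    ring
  · fin_cases i <;> fin_cases l <;> simp [h1, h2, h3, h4] <;> field_simp <;> ring

lemma weight_neg (p q h : ℝ) (k : Fin 3 → ℝ) (A : Fin 3 → Fin 3 → ℝ) :
    weight p q h (-k) A = weight p q h k A := by
  simp [weight]

lemma contDiff_weight (p q h : ℝ) (k : Fin 3 → ℝ) {n : WithTop ℕ∞} :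
    ContDiff ℝ n (weight p q h k) := by
  unfold weight
  fun_prop

lemma weight_baseMatrix {p q : ℝ} (hp : p ≠ 0) (h : ℝ) (k : Fin 3 → ℝ) :
    weight p q h k (baseMatrix p q) = 1 / 16 := by
  have hr : p ^ 2 + q ^ 2 ≠ 0 := by positivity
  simp [weight, baseMatrix]
  field_simp
  ring

lemma eventually_weight_pos {p q : ℝ} (hp : p ≠ 0) (h : ℝ) (s : Finset (Fin 3 → ℝ)) :
    ∀ᶠ N in nhds (0 : Fin 3 → Fin 3 → ℝ), ∀ k ∈ s, 0 < weight p q h k (baseMatrix p q + N) := by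
  rw [Filter.eventually_all_finset]
  intro k _
  have hc : Continuous fun N => weight p q h k (baseMatrix p q + N) :=
    (contDiff_weight p q h k (n := 0)).continuous.comp (continuous_const.add continuous_id)
  refine hc.continuousAt.eventually_const_lt ?_
  simp [weight_baseMatrix hp]

/-- **The geometric lemma: choosing frequency modes.** -/
theorem choosing_frequency_modes :
    ∃ (Mj : Fin 2 → Fin 3 → Fin 3 → ℝ) (ε : ℝ) (Ω : Fin 2 → Finset (Fin 3 → ℝ))
      (c : Fin 2 → (Fin 3 → ℝ) → (Fin 3 → Fin 3 → ℝ) → ℝ),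
      0 < ε ∧
      (∀ j, Mj j ∈ MSet) ∧
      -- the two families of frequencies are disjoint
      Disjoint (Ω 0) (Ω 1) ∧
      -- the frequencies are unit vectors with rational coordinates
      (∀ j, ∀ k ∈ Ω j, (∑ i, (k i) ^ 2) = 1 ∧ ∀ i, ∃ q : ℚ, k i = (q : ℝ)) ∧
      -- (1) each Ω_j is at positive distance from the z-axis
      (∀ j, ∀ k ∈ Ω j, ¬(k 0 = 0 ∧ k 1 = 0)) ∧
      -- (2) Ω_j = −Ω_j and c_{j,k} = c_{j,−k}
      (∀ j, ∀ k : Fin 3 → ℝ, k ∈ Ω j ↔ -k ∈ Ω j) ∧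
      (∀ j, ∀ k ∈ Ω j, ∀ A, c j k A = c j (-k) A) ∧
      -- (3) 13 Ω_j ⊆ ℤ³
      (∀ j, ∀ k ∈ Ω j, ∀ i, ∃ m : ℤ, 13 * k i = (m : ℝ)) ∧
      -- the coefficients are smooth and positive on the ε-ball around M_j inside 𝓜
      (∀ j, ∀ k ∈ Ω j,
        ContDiffOn ℝ (⊤ : ℕ∞) (c j k) {A | A ∈ MSet ∧ ‖A - Mj j‖ < ε} ∧
        ∀ A ∈ MSet, ‖A - Mj j‖ < ε → 0 < c j k A) ∧
      -- (4) the decomposition M = (1/2) Σ_k c_{j,k}(M)² k ⊗ k̄⊥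
      (∀ j, ∀ A ∈ MSet, ‖A - Mj j‖ < ε →
        A = fun i l => (1 / 2) * ∑ k ∈ Ω j, (c j k A) ^ 2 * (k i * kperp k l)) ∧
      -- (5) normalization when the perturbation has symmetric top-left block
      (∀ j, ∀ N ∈ MSet, N 0 1 = N 1 0 → ‖N‖ < ε →
        (∑ k ∈ Ω j, (c j k (Mj j + N)) ^ 2) = 1) := by
  let p : Fin 2 → ℤ := ![3, 12]
  let q : Fin 2 → ℤ := ![4, 4]
  let h : Fin 2 → ℤ := ![12, 3]
  have hp : ∀ j, p j ≠ 0 := by decide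
  have hq : ∀ j, q j ≠ 0 := by decide
  have hh : ∀ j, h j ≠ 0 := by decide
  have hpq : ∀ j, p j ^ 2 ≠ q j ^ 2 := by decide
  have hsum : ∀ j, p j ^ 2 + q j ^ 2 + h j ^ 2 = 169 := by decide
  have hp' (j) : (p j : ℝ) ≠ 0 := by exact_mod_cast hp j
  have hr (j) : (0 : ℝ) < (p j : ℝ) ^ 2 + (q j : ℝ) ^ 2 := by have := hp' j; positivity
  obtain ⟨ε, hε, hpos⟩ := Metric.eventually_nhds_iff.1 (Filter.eventually_all.2 fun j =>
    eventually_weight_pos (q := q j) (hp' j) (h j) (frequencySet (p j) (q j) (h j)))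
  have hpos' (j : Fin 2) (A : Fin 3 → Fin 3 → ℝ) (hA : ‖A - baseMatrix (p j) (q j)‖ < ε)
      (k) (hk : k ∈ frequencySet (p j) (q j) (h j)) :
      0 < weight (p j) (q j) (h j) k A := by
    simpa using hpos (y := A - baseMatrix (p j) (q j)) (by simpa using hA) j k hk
  refine ⟨fun j => baseMatrix (p j) (q j), ε, fun j => frequencySet (p j) (q j) (h j),
    fun j k A => √(weight (p j) (q j) (h j) k A), hε, fun j => baseMatrix_mem _ _, ?_, ?_, ?_, ?_,
    ?_, ?_, ?_, ?_, ?_⟩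
  · rw [Finset.disjoint_left]
    intro k h0 h1
    have := (sq_of_mem_frequencySet h0).symm.trans (sq_of_mem_frequencySet h1)
    norm_num [h] at this
  · refine fun j k hk => ⟨?_, fun i => ?_⟩
    · have hsum' : (p j : ℝ) ^ 2 + (q j : ℝ) ^ 2 + (h j : ℝ) ^ 2 = 169 := by
        exact_mod_cast hsum j
      rw [Fin.sum_univ_three, sq_add_sq_of_mem_frequencySet hk, sq_of_mem_frequencySet hk,
        ← add_div, hsum', div_self (by norm_num)]
    · obtain ⟨m, hm⟩ := exists_int_of_mem_frequencySet hk i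
      refine ⟨m / 13, ?_⟩
      push_cast
      linarith
  · rintro j k hk ⟨h0, h1⟩
    have := sq_add_sq_of_mem_frequencySet hk
    rw [h0, h1] at this
    linarith [hr j]
  · exact fun j k => ⟨neg_mem_frequencySet, fun hk => neg_neg k ▸ neg_mem_frequencySet hk⟩
  · intro j k _ A
    simp only [weight_neg]
  · exact fun j k hk i => exists_int_of_mem_frequencySet hk i
  · refine fun j k hk => ⟨?_, fun A _ hA => Real.sqrt_pos.2 (hpos' j A hA k hk)⟩
    exact (contDiff_weight _ _ _ k).contDiffOn.sqrt fun A hA => (hpos' j A hA.2 k hk).ne'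
  · intro j A hA hAε
    ext i l
    rw [Finset.sum_congr rfl fun k hk => by rw [Real.sq_sqrt (hpos' j A hAε k hk).le],
      sum_weight_mul (hp j) (hq j) (hh j) (hpq j) hA]
    ring
  · intro j N _ hsymm hNε
    have hball : ‖baseMatrix (p j) (q j) + N - baseMatrix (p j) (q j)‖ < ε := by simpa using hNε
    rw [Finset.sum_congr rfl fun k hk => Real.sq_sqrt (hpos' j _ hball k hk).le,
      sum_weight (hp j) (hq j) (hh j) (hpq j), div_eq_one_iff_eq (hr j).ne']
    simp [baseMatrix, hsymm]
    ring

end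
end
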